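/- Let S be a finite family of n curves in the plane, each colored red or blue, such that no two curves of the same color intersect. Let C be a family of pairwise disjoint curves which is grounded with respect to S and such that each c ∈ C intersects exactly two members of S and distinct members of C intersect distinct pairs of members of S. Then |C| ≤ 33n − 25. -/

import Mathlib

open Set

/-- Points of the plane. -/
abbrev Pt : Type := ℝ × ℝ

/-- A curve: the image of an injective continuous map from `[0,1]` to the plane. -/
def IsCurve (s : Set Pt) : Prop :=
  ∃ f : ℝ → Pt, ContinuousOn f (Set.Icc 0 1) ∧ Set.InjOn f (Set.Icc 0 1) ∧
    s = f '' Set.Icc 0 1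

/-- A simple polygonal chain consisting of finitely many line segments. -/
def IsPolygonalCurve (s : Set Pt) : Prop :=
  IsCurve s ∧ ∃ P : Finset (Pt × Pt), s = ⋃ p ∈ P, segment ℝ p.1 p.2

/-- The family `C` is grounded with respect to `S` if some connected component of the
complement of `⋃ S` contains at least one point of every curve in `C`. -/
def Grounded {ι κ : Type*} (C : ι → Set Pt) (S : κ → Set Pt) : Prop :=
  ∃ x : Pt, x ∉ (⋃ k, S k) ∧
    ∀ i, (connectedComponentIn (⋃ k, S k)ᶜ x ∩ C i).Nonempty

/-- The total change of a continuous logarithm of `g` along `[0,1]`. -/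
noncomputable def logVar (g : ℝ → ℂ) : ℂ :=
  open Classical in
  if h : ∃ F : ℝ → ℂ, Continuous F ∧ ∀ t, Complex.exp (F t) = g t then h.choose 1 - h.choose 0
  else 0

theorem logVar_eq {g F : ℝ → ℂ} (hF : Continuous F) (h : ∀ t, Complex.exp (F t) = g t) :
    logVar g = F 1 - F 0 := by
  have hex : ∃ F : ℝ → ℂ, Continuous F ∧ ∀ t, Complex.exp (F t) = g t := ⟨F, hF, h⟩
  rw [logVar, dif_pos hex]
  obtain ⟨hc, he⟩ := hex.choose_spec
  set K := hex.choose
  have hdiff : ∀ t, ∃ n : ℤ, (K t - F t) = n * (2 * Real.pi * Complex.I) := by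
    intro t
    have : Complex.exp (K t) = Complex.exp (F t) := by rw [he, h]
    obtain ⟨n, hn⟩ := Complex.exp_eq_exp_iff_exists_int.1 this
    exact ⟨n, by rw [hn]; ring⟩
  choose n hn using hdiff
  have hpi : (2 * Real.pi * Complex.I) ≠ 0 := Complex.two_pi_I_ne_zero
  have hcont : Continuous fun t => ((n t : ℤ) : ℝ) := by
    have h1 : (fun t => ((n t : ℤ) : ℝ)) =
        fun t => ((K t - F t) / (2 * Real.pi * Complex.I)).re := by
      funext t
      rw [hn t, mul_div_cancel_right₀ _ hpi]; simp
    rw [h1]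
    fun_prop
  have hcont' : Continuous n := Int.isClosedEmbedding_coe_real.continuous_iff.2 hcont
  have hn01 : n 1 = n 0 := PreconnectedSpace.constant inferInstance hcont'
  have e1 := hn 1
  have e0 := hn 0
  rw [hn01, ← e0] at e1
  linear_combination e1

theorem exists_continuous_log {X : Type*} [TopologicalSpace X] [SimplyConnectedSpace X]
    [LocallyPathConnectedSpace X] {g : X → ℂ} (hg : Continuous g) (h0 : ∀ x, g x ≠ 0) :
    ∃ F : X → ℂ, Continuous F ∧ ∀ x, Complex.exp (F x) = g x := by
  obtain ⟨x₀⟩ : Nonempty X := inferInstance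
  obtain ⟨F, ⟨-, hF⟩, -⟩ := Complex.isCoveringMapOn_exp.existsUnique_continuousMap_lifts
    ⟨g, hg⟩ (Complex.exp_log (h0 x₀)) h0
  exact ⟨F, F.continuous, fun x => congrFun hF x⟩

theorem exp_logVar {g : ℝ → ℂ} (hg : Continuous g) (h0 : ∀ x, g x ≠ 0) :
    Complex.exp (logVar g) = g 1 / g 0 := by
  obtain ⟨F, hF, h⟩ := exists_continuous_log hg h0
  rw [logVar_eq hF h, Complex.exp_sub, h, h]

theorem logVar_square {f g : ℝ → ℂ} (hf : Continuous f) (hg : Continuous g)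
    (h : ∀ s t, f s ≠ g t) :
    logVar (fun s => f s - g 0) + logVar (fun t => g t - f 1) =
      logVar (fun t => g t - f 0) + logVar (fun s => f s - g 1) := by
  obtain ⟨F, hF, hexp⟩ := exists_continuous_log (X := ℝ × ℝ) (g := fun p => f p.1 - g p.2)
    (by fun_prop) (fun p => sub_ne_zero.2 (h _ _))
  have hneg : ∀ x t, Complex.exp (F (x, t) + Real.pi * Complex.I) = g t - f x := by
    intro x t
    rw [Complex.exp_add, hexp, Complex.exp_pi_mul_I]; ring
  rw [logVar_eq (F := fun s => F (s, 0)) (by fun_prop) (fun s => hexp _),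
    logVar_eq (F := fun s => F (s, 1)) (by fun_prop) (fun s => hexp _),
    logVar_eq (F := fun t => F (1, t) + Real.pi * Complex.I) (by fun_prop) (fun t => hneg _ _),
    logVar_eq (F := fun t => F (0, t) + Real.pi * Complex.I) (by fun_prop) (fun t => hneg _ _)]
  ring

/-- A choice of logarithm of `P y - P x`. -/
noncomputable def edgeLog (P : Fin 5 → ℂ) (x y : Fin 5) : ℂ :=
  if x < y then Complex.log (P y - P x) else Complex.log (P x - P y) + Real.pi * Complex.I

theorem exp_edgeLog {P : Fin 5 → ℂ} {x y : Fin 5} (h : P x ≠ P y) :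
    Complex.exp (edgeLog P x y) = P y - P x := by
  unfold edgeLog
  split_ifs
  · exact Complex.exp_log (sub_ne_zero.2 h.symm)
  · rw [Complex.exp_add, Complex.exp_log (sub_ne_zero.2 h), Complex.exp_pi_mul_I]; ring

/-- There is no drawing of `K₅` in the plane in which independent edges are disjoint. -/
theorem not_planar_K5 (P : Fin 5 → ℂ) (γ : Fin 5 → Fin 5 → ℝ → ℂ)
    (hc : ∀ a b, a < b → Continuous (γ a b))
    (h0 : ∀ a b, a < b → γ a b 0 = P a) (h1 : ∀ a b, a < b → γ a b 1 = P b)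
    (hdisj : ∀ a b c d, a < b → c < d → a ≠ c → a ≠ d → b ≠ c → b ≠ d →
      ∀ s t, γ a b s ≠ γ c d t) : False := by
  have hv : ∀ a b c, a < b → c ≠ a → c ≠ b → ∀ s, γ a b s ≠ P c := by
    intro a b c hab hca hcb s
    obtain ⟨d, hda, hdb, hdc⟩ : ∃ d, d ≠ a ∧ d ≠ b ∧ d ≠ c := by
      revert a b c; decide
    rcases lt_or_gt_of_ne hdc with h | h
    · rw [← h1 d c h]; exact hdisj a b d c hab h hda.symm hca.symm hdb.symm hcb.symm s 1
    · rw [← h0 c d h]; exact hdisj a b c d hab h hca.symm hda.symm hcb.symm hdb.symm s 0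
  have hP : ∀ a b, a ≠ b → P a ≠ P b := by
    intro a b hab
    obtain ⟨c, hca, hcb⟩ : ∃ c, c ≠ a ∧ c ≠ b := by revert a b; decide
    rcases lt_or_gt_of_ne hca with h | h
    · rw [← h1 c a h]; exact hv c a b h hcb.symm hab.symm 1
    · rw [← h0 a c h]; exact hv a c b h hab.symm hcb.symm 0
  have hk : ∀ a b c, ∃ k : ℤ, a < b → c ≠ a → c ≠ b →
      logVar (fun s => γ a b s - P c) =
        edgeLog P c b - edgeLog P c a + k * (2 * Real.pi * Complex.I) := by
    intro a b c
    by_cases h : a < b ∧ c ≠ a ∧ c ≠ b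
    · obtain ⟨hab, hca, hcb⟩ := h
      have hcont := hc a b hab
      have h2 := exp_logVar (g := fun s => γ a b s - P c) (by fun_prop)
        (fun s => sub_ne_zero.2 (hv a b c hab hca hcb s))
      simp only [h0 a b hab, h1 a b hab] at h2
      rw [← exp_edgeLog (hP c b hcb), ← exp_edgeLog (hP c a hca), ← Complex.exp_sub,
        Complex.exp_eq_exp_iff_exists_int] at h2
      obtain ⟨k, hk⟩ := h2
      exact ⟨k, fun _ _ _ => hk⟩
    · exact ⟨0, fun x y z => absurd ⟨x, y, z⟩ h⟩
  choose k hk using hk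
  have hanti : ∀ x y, x ≠ y → edgeLog P x y - edgeLog P y x =
      ((if x < y then (-1 : ℤ) else 1 : ℤ) : ℂ) * (Real.pi * Complex.I) := by
    intro x y hxy
    unfold edgeLog
    rcases lt_or_gt_of_ne hxy with h | h
    · rw [if_pos h, if_neg h.not_gt, if_pos h]; push_cast; ring
    · rw [if_neg h.not_gt, if_pos h, if_neg h.not_gt]; push_cast; ring
  have key : ∀ a b c d, a < b → c < d → a ≠ c → a ≠ d → b ≠ c → b ≠ d →
      (if c < b then (-1 : ℤ) else 1) - (if c < a then (-1 : ℤ) else 1)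
      - (if d < b then (-1 : ℤ) else 1) + (if d < a then (-1 : ℤ) else 1)
      + 2 * (k a b c + k c d b - k c d a - k a b d) = 0 := by
    intro a b c d hab hcd hac had hbc hbd
    have hcab := hc a b hab
    have hccd := hc c d hcd
    have e := logVar_square hcab hccd (hdisj a b c d hab hcd hac had hbc hbd)
    rw [h0 a b hab, h1 a b hab, h0 c d hcd, h1 c d hcd, hk a b c hab hac.symm hbc.symm,
      hk a b d hab had.symm hbd.symm, hk c d a hcd hac had, hk c d b hcd hbc hbd] at e
    have e1 := hanti c b hbc.symm
    have e2 := hanti c a hac.symm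
    have e3 := hanti d b hbd.symm
    have e4 := hanti d a had.symm
    have hpi : (Real.pi * Complex.I : ℂ) ≠ 0 := by
      simp [Real.pi_ne_zero]
    have : (((if c < b then (-1 : ℤ) else 1) - (if c < a then (-1 : ℤ) else 1)
      - (if d < b then (-1 : ℤ) else 1) + (if d < a then (-1 : ℤ) else 1)
      + 2 * (k a b c + k c d b - k c d a - k a b d) : ℤ) : ℂ) * (Real.pi * Complex.I) = 0 := by
      push_cast at e1 e2 e3 e4 ⊢
      linear_combination e - e1 + e2 + e3 - e4
    have := (mul_eq_zero.1 this).resolve_right hpi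
    exact_mod_cast this
  have E1 := key 0 1 2 3 (by decide) (by decide) (by decide) (by decide) (by decide) (by decide)
  have E2 := key 0 1 2 4 (by decide) (by decide) (by decide) (by decide) (by decide) (by decide)
  have E3 := key 0 1 3 4 (by decide) (by decide) (by decide) (by decide) (by decide) (by decide)
  have E4 := key 0 2 1 3 (by decide) (by decide) (by decide) (by decide) (by decide) (by decide)
  have E5 := key 0 2 1 4 (by decide) (by decide) (by decide) (by decide) (by decide) (by decide)
  have E6 := key 0 2 3 4 (by decide) (by decide) (by decide) (by decide) (by decide) (by decide)
  have E7 := key 0 3 1 2 (by decide) (by decide) (by decide) (by decide) (by decide) (by decide)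
  have E8 := key 0 3 1 4 (by decide) (by decide) (by decide) (by decide) (by decide) (by decide)
  have E9 := key 0 3 2 4 (by decide) (by decide) (by decide) (by decide) (by decide) (by decide)
  have E10 := key 0 4 1 2 (by decide) (by decide) (by decide) (by decide) (by decide) (by decide)
  have E11 := key 0 4 1 3 (by decide) (by decide) (by decide) (by decide) (by decide) (by decide)
  have E12 := key 0 4 2 3 (by decide) (by decide) (by decide) (by decide) (by decide) (by decide)
  have E13 := key 1 2 3 4 (by decide) (by decide) (by decide) (by decide) (by decide) (by decide)
  have E14 := key 1 3 2 4 (by decide) (by decide) (by decide) (by decide) (by decide) (by decide)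
  have E15 := key 1 4 2 3 (by decide) (by decide) (by decide) (by decide) (by decide) (by decide)
  clear key hk hanti hP hv hdisj h0 h1 hc
  simp (decide := true) only [if_true, if_false]
    at E1 E2 E3 E4 E5 E6 E7 E8 E9 E10 E11 E12 E13 E14 E15
  omega

/-- The vertices in `W` and the edges of `G` between them can be drawn as path-connected sets in
the plane: vertices are pairwise disjoint, an edge meets its two ends and no other vertex, and
edges without a common end are disjoint. -/
structure IsDrawing {V : Type*} (W : Finset V) (G : SimpleGraph V) (X : V → Set Pt)
    (E : V → V → Set Pt) : Prop where
  vert : ∀ v ∈ W, IsPathConnected (X v)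
  vert_disj : ∀ u ∈ W, ∀ v ∈ W, u ≠ v → Disjoint (X u) (X v)
  edge : ∀ u ∈ W, ∀ v ∈ W, G.Adj u v → IsPathConnected (E u v)
  left : ∀ u ∈ W, ∀ v ∈ W, G.Adj u v → (X u ∩ E u v).Nonempty
  right : ∀ u ∈ W, ∀ v ∈ W, G.Adj u v → (E u v ∩ X v).Nonempty
  edge_vert : ∀ u ∈ W, ∀ v ∈ W, G.Adj u v → ∀ w ∈ W, w ≠ u → w ≠ v → Disjoint (E u v) (X w)
  edge_disj : ∀ u ∈ W, ∀ v ∈ W, G.Adj u v → ∀ w ∈ W, ∀ z ∈ W, G.Adj w z →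
    u ≠ w → u ≠ z → v ≠ w → v ≠ z → Disjoint (E u v) (E w z)

/-- `G` restricted to `W` has a drawing. -/
def Drawable {V : Type*} (W : Finset V) (G : SimpleGraph V) : Prop :=
  ∃ X E, IsDrawing W G X E

namespace Drawable

variable {V : Type*} {W : Finset V} {G : SimpleGraph V}

theorem mono (h : Drawable W G) {W' : Finset V} {G' : SimpleGraph V} (hW : W' ⊆ W) (hG : G' ≤ G) :
    Drawable W' G' := by
  obtain ⟨X, E, h⟩ := h
  exact ⟨X, E, fun v hv => h.vert v (hW hv), fun u hu v hv => h.vert_disj u (hW hu) v (hW hv),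
    fun u hu v hv ha => h.edge u (hW hu) v (hW hv) (hG ha),
    fun u hu v hv ha => h.left u (hW hu) v (hW hv) (hG ha),
    fun u hu v hv ha => h.right u (hW hu) v (hW hv) (hG ha),
    fun u hu v hv ha w hw => h.edge_vert u (hW hu) v (hW hv) (hG ha) w (hW hw),
    fun u hu v hv ha w hw z hz hb =>
      h.edge_disj u (hW hu) v (hW hv) (hG ha) w (hW hw) z (hW hz) (hG hb)⟩

theorem not_K5 (h : Drawable W G) (e : Fin 5 → V) (he : ∀ i, e i ∈ W)
    (hadj : ∀ i j, i < j → G.Adj (e i) (e j)) : False := by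
  obtain ⟨X, E, h⟩ := h
  have hinj : ∀ i j, i ≠ j → e i ≠ e j := by
    intro i j hij
    rcases lt_or_gt_of_ne hij with hl | hl
    · exact (hadj i j hl).ne
    · exact (hadj j i hl).ne'
  choose P hP using fun i => (h.vert _ (he i)).nonempty
  set U : Fin 5 → Fin 5 → Set Pt := fun i j => X (e i) ∪ E (e i) (e j) ∪ X (e j) with hU
  have hjoin : ∀ i j, i < j → JoinedIn (U i j) (P i) (P j) := by
    intro i j hij
    have h1 := (h.vert _ (he i)).union (h.edge _ (he i) _ (he j) (hadj i j hij))
      (h.left _ (he i) _ (he j) (hadj i j hij))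
    have h2 := h1.union (h.vert _ (he j))
      ((h.right _ (he i) _ (he j) (hadj i j hij)).mono (by gcongr; exact subset_union_right))
    exact h2.joinedIn _ (Or.inl (Or.inl (hP i))) _ (Or.inr (hP j))
  set φ := Complex.equivRealProdCLM.symm
  have hpath : ∀ i j, ∃ γ : ℝ → Pt, i < j → Continuous γ ∧ γ 0 = P i ∧ γ 1 = P j ∧
      ∀ t, γ t ∈ U i j := by
    intro i j
    by_cases hij : i < j
    · obtain ⟨p, hp⟩ := hjoin i j hij
      exact ⟨p.extend, fun _ => ⟨p.continuous_extend, by simp, by simp, fun t => hp _⟩⟩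
    · exact ⟨fun _ => 0, fun h => absurd h hij⟩
  choose γ hγ using hpath
  refine not_planar_K5 (fun i => φ (P i)) (fun i j t => φ (γ i j t)) ?_ ?_ ?_ ?_
  · intro a b hab
    exact φ.continuous.comp (hγ a b hab).1
  · intro a b hab
    simp only [(hγ a b hab).2.1]
  · intro a b hab
    simp only [(hγ a b hab).2.2.1]
  · intro a b c d hab hcd hac had hbc hbd s t hst
    have hst' := φ.injective hst
    have h1 := (hγ a b hab).2.2.2 s
    have h2 := (hγ c d hcd).2.2.2 t
    rw [← hst'] at h2
    have hUU : Disjoint (U a b) (U c d) := by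
      have i1 := hinj a c hac
      have i2 := hinj a d had
      have i3 := hinj b c hbc
      have i4 := hinj b d hbd
      have A1 := hadj a b hab
      have A2 := hadj c d hcd
      simp only [hU, disjoint_union_left, disjoint_union_right]
      refine ⟨⟨⟨⟨?_, ?_⟩, ?_⟩, ⟨?_, ?_⟩, ?_⟩, ⟨?_, ?_⟩, ?_⟩
      · exact h.vert_disj _ (he _) _ (he _) i1
      · exact h.edge_vert _ (he _) _ (he _) A1 _ (he _) i1.symm i3.symm
      · exact h.vert_disj _ (he _) _ (he _) i3
      · exact (h.edge_vert _ (he _) _ (he _) A2 _ (he _) i1 i2).symm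
      · exact h.edge_disj _ (he _) _ (he _) A1 _ (he _) _ (he _) A2 i1 i2 i3 i4
      · exact (h.edge_vert _ (he _) _ (he _) A2 _ (he _) i3 i4).symm
      · exact h.vert_disj _ (he _) _ (he _) i2
      · exact h.edge_vert _ (he _) _ (he _) A1 _ (he _) i2.symm i4.symm
      · exact h.vert_disj _ (he _) _ (he _) i4
    exact disjoint_left.1 hUU h1 h2

end Drawable

/-- The graph obtained by contracting `v` into `u`, with `v` left isolated. -/
def contractInto {V : Type*} (G : SimpleGraph V) (u v : V) : SimpleGraph V where
  Adj x y := x ≠ y ∧ x ≠ v ∧ y ≠ v ∧ (G.Adj x y ∨ (x = u ∧ G.Adj v y) ∨ (y = u ∧ G.Adj x v))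
  symm := ⟨fun x y => by
    rintro ⟨h1, h2, h3, h | ⟨h, h'⟩ | ⟨h, h'⟩⟩
    · exact ⟨h1.symm, h3, h2, Or.inl h.symm⟩
    · exact ⟨h1.symm, h3, h2, Or.inr (Or.inr ⟨h, h'.symm⟩)⟩
    · exact ⟨h1.symm, h3, h2, Or.inr (Or.inl ⟨h, h'.symm⟩)⟩⟩
  loopless := ⟨fun x h => h.1 rfl⟩

theorem Drawable.contract {V : Type*} [DecidableEq V] {W : Finset V} {G : SimpleGraph V}
    (h : Drawable W G) {u v : V} (hu : u ∈ W) (hv : v ∈ W) (huv : G.Adj u v) :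
    Drawable (W.erase v) (contractInto G u v) := by
  obtain ⟨X, E, h⟩ := h
  have hrep : ∀ x y, ∃ a b, (contractInto G u v).Adj x y →
      G.Adj a b ∧ (a = x ∨ x = u ∧ a = v) ∧ (b = y ∨ y = u ∧ b = v) := by
    intro x y
    by_cases hxy : (contractInto G u v).Adj x y
    · obtain ⟨h1, h2, h3, h | ⟨h, h'⟩ | ⟨h, h'⟩⟩ := hxy
      · exact ⟨x, y, fun _ => ⟨h, Or.inl rfl, Or.inl rfl⟩⟩
      · exact ⟨v, y, fun _ => ⟨h', Or.inr ⟨h, rfl⟩, Or.inl rfl⟩⟩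
      · exact ⟨x, v, fun _ => ⟨h', Or.inl rfl, Or.inr ⟨h, rfl⟩⟩⟩
    · exact ⟨x, y, fun h => absurd h hxy⟩
  choose a b hab using hrep
  set X' : V → Set Pt := fun x => if x = u then X u ∪ E u v ∪ X v else X x with hX'
  have hXu : X' u = X u ∪ E u v ∪ X v := by simp [hX']
  have hXn : ∀ x, x ≠ u → X' x = X x := fun x hx => by simp [hX', hx]
  have hmem : ∀ x ∈ W.erase v, ∀ c, (c = x ∨ x = u ∧ c = v) → c ∈ W ∧ X c ⊆ X' x := by
    rintro x hx c (rfl | ⟨rfl, rfl⟩)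
    · refine ⟨Finset.mem_of_mem_erase hx, ?_⟩
      by_cases hc : c = u
      · subst hc; rw [hXu]; exact fun p hp => Or.inl (Or.inl hp)
      · rw [hXn _ hc]
    · exact ⟨hv, by rw [hXu]; exact fun p hp => Or.inr hp⟩
  have hne : ∀ x ∈ W.erase v, ∀ y ∈ W.erase v, x ≠ y → ∀ c d, (c = x ∨ x = u ∧ c = v) →
      (d = y ∨ y = u ∧ d = v) → c ≠ d := by
    rintro x hx y hy hxy c d (rfl | ⟨rfl, rfl⟩) (rfl | ⟨rfl, rfl⟩)
    · exact hxy
    · exact Finset.ne_of_mem_erase hx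
    · exact (Finset.ne_of_mem_erase hy).symm
    · exact absurd rfl hxy
  refine ⟨X', fun x y => E (a x y) (b x y), ?_, ?_, ?_, ?_, ?_, ?_, ?_⟩
  · intro x hx
    by_cases hxu : x = u
    · subst hxu
      rw [hXu]
      have h1 := (h.vert _ hu).union (h.edge _ hu _ hv huv) (h.left _ hu _ hv huv)
      exact h1.union (h.vert _ hv)
        ((h.right _ hu _ hv huv).mono (by gcongr; exact subset_union_right))
    · rw [hXn x hxu]; exact h.vert x (Finset.mem_of_mem_erase hx)
  · have aux : ∀ y ∈ W.erase v, y ≠ u → Disjoint (X' u) (X' y) := by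
      intro y hy hyu
      have hyv := Finset.ne_of_mem_erase hy
      have hyW := Finset.mem_of_mem_erase hy
      rw [hXu, hXn y hyu]
      simp only [disjoint_union_left]
      exact ⟨⟨h.vert_disj _ hu _ hyW hyu.symm, h.edge_vert _ hu _ hv huv _ hyW hyu hyv⟩,
        h.vert_disj _ hv _ hyW hyv.symm⟩
    intro x hx y hy hxy
    by_cases hxu : x = u
    · subst hxu; exact aux y hy hxy.symm
    by_cases hyu : y = u
    · subst hyu; exact (aux x hx hxy).symm
    rw [hXn x hxu, hXn y hyu]
    exact h.vert_disj _ (Finset.mem_of_mem_erase hx) _ (Finset.mem_of_mem_erase hy) hxy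
  · intro x hx y hy hxy
    obtain ⟨h1, h2, h3⟩ := hab x y hxy
    exact h.edge _ (hmem x hx _ h2).1 _ (hmem y hy _ h3).1 h1
  · intro x hx y hy hxy
    obtain ⟨h1, h2, h3⟩ := hab x y hxy
    exact (h.left _ (hmem x hx _ h2).1 _ (hmem y hy _ h3).1 h1).mono
      (inter_subset_inter_left _ (hmem x hx _ h2).2)
  · intro x hx y hy hxy
    obtain ⟨h1, h2, h3⟩ := hab x y hxy
    exact (h.right _ (hmem x hx _ h2).1 _ (hmem y hy _ h3).1 h1).mono
      (inter_subset_inter_right _ (hmem y hy _ h3).2)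
  · intro x hx y hy hxy w hw hwx hwy
    obtain ⟨h1, h2, h3⟩ := hab x y hxy
    have ma := (hmem x hx _ h2).1
    have mb := (hmem y hy _ h3).1
    have na := hne x hx w hw hwx.symm _ w h2 (Or.inl rfl)
    have nb := hne y hy w hw hwy.symm _ w h3 (Or.inl rfl)
    by_cases hwu : w = u
    · subst hwu
      have na' := hne x hx w hw hwx.symm _ v h2 (Or.inr ⟨rfl, rfl⟩)
      have nb' := hne y hy w hw hwy.symm _ v h3 (Or.inr ⟨rfl, rfl⟩)
      rw [hXu]
      simp only [disjoint_union_right]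
      exact ⟨⟨h.edge_vert _ ma _ mb h1 _ hu na.symm nb.symm,
        h.edge_disj _ ma _ mb h1 _ hu _ hv huv na na' nb nb'⟩,
        h.edge_vert _ ma _ mb h1 _ hv na'.symm nb'.symm⟩
    · rw [hXn w hwu]
      exact h.edge_vert _ ma _ mb h1 _ (Finset.mem_of_mem_erase hw) na.symm nb.symm
  · intro x hx y hy hxy w hw z hz hwz n1 n2 n3 n4
    obtain ⟨h1, h2, h3⟩ := hab x y hxy
    obtain ⟨k1, k2, k3⟩ := hab w z hwz
    exact h.edge_disj _ (hmem x hx _ h2).1 _ (hmem y hy _ h3).1 h1 _ (hmem w hw _ k2).1 _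
      (hmem z hz _ k3).1 k1 (hne x hx w hw n1 _ _ h2 k2) (hne x hx z hz n2 _ _ h2 k3)
      (hne y hy w hw n3 _ _ h3 k2) (hne y hy z hz n4 _ _ h3 k3)

theorem card_edgeSet_le_contractInto {V : Type*} [Finite V] (G : SimpleGraph V) {u v : V}
    (huv : G.Adj u v) :
    G.edgeSet.ncard ≤ (contractInto G u v).edgeSet.ncard + 1 +
      (G.neighborSet u ∩ G.neighborSet v).ncard := by
  classical
  have := Fintype.ofFinite V
  set A := G.edgeSet \ G.incidenceSet v
  set N := (G.neighborSet v \ {u}) \ G.neighborSet u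
  set B := (fun y => s(u, y)) '' N
  have hinj : Function.Injective fun y => s(u, y) := by
    intro x y hxy
    exact Sym2.congr_right.1 hxy
  have hB : B.ncard = N.ncard := ncard_image_of_injective _ hinj
  have hsub : A ∪ B ⊆ (contractInto G u v).edgeSet := by
    rintro e (he | ⟨y, ⟨⟨hy1, hy2⟩, hy3⟩, rfl⟩)
    · induction e using Sym2.ind with
      | _ x y =>
        obtain ⟨h1, h2⟩ := he
        have h1' : G.Adj x y := h1
        have h3 : ¬ (v ∈ s(x, y)) := fun h => h2 ⟨h1, h⟩
        simp only [Sym2.mem_iff, not_or] at h3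
        exact ⟨h1'.ne, Ne.symm h3.1, Ne.symm h3.2, Or.inl h1'⟩
    · exact ⟨fun h => hy2 h.symm, huv.ne, fun h => G.loopless.irrefl v
          (by change y = v at h; rw [h] at hy1; exact hy1),
        Or.inr (Or.inl ⟨rfl, hy1⟩)⟩
  have hdisj : Disjoint A B := by
    rw [disjoint_left]
    rintro e he ⟨y, ⟨⟨hy1, hy2⟩, hy3⟩, rfl⟩
    exact hy3 he.1
  have h1 : A.ncard + B.ncard ≤ (contractInto G u v).edgeSet.ncard := by
    rw [← ncard_union_eq hdisj]
    exact ncard_le_ncard hsub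
  have h2 : G.edgeSet.ncard = A.ncard + (G.incidenceSet v).ncard :=
    (ncard_sdiff_add_ncard_of_subset (fun e he => he.1)).symm
  have h3 : (G.incidenceSet v).ncard = (G.neighborSet v).ncard := by
    simp only [← Nat.card_coe_set_eq]
    exact Nat.card_congr (G.incidenceSetEquivNeighborSet v)
  have h4 : (G.neighborSet v).ncard ≤ N.ncard + 1 + (G.neighborSet u ∩ G.neighborSet v).ncard := by
    have hs : G.neighborSet v ⊆ N ∪ {u} ∪ (G.neighborSet u ∩ G.neighborSet v) := by
      intro y hy
      by_cases h : y = u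
      · exact Or.inl (Or.inr h)
      by_cases h' : y ∈ G.neighborSet u
      · exact Or.inr ⟨h', hy⟩
      · exact Or.inl (Or.inl ⟨⟨hy, h⟩, h'⟩)
    calc _ ≤ _ := ncard_le_ncard hs
      _ ≤ _ := ncard_union_le _ _
      _ ≤ _ := by
        gcongr
        exact (ncard_union_le _ _).trans (by simp)
  omega

theorem Drawable.card_edgeSet_le {V : Type*} [Finite V] :
    ∀ (n : ℕ) (W : Finset V) (G : SimpleGraph V), W.card = n → W.Nonempty →
      (∀ x y, G.Adj x y → x ∈ W) → Drawable W G → G.edgeSet.ncard + 3 ≤ 3 * n := by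
  classical
  have := Fintype.ofFinite V
  intro n
  induction n with
  | zero =>
    intro W G hn hW
    exact absurd hn hW.card_pos.ne'
  | succ n ih =>
    intro W G₀ hn hW hsupp₀ hD₀
    by_contra hcon
    obtain ⟨T, hT, hTc⟩ : ∃ T ⊆ G₀.edgeSet, T.ncard = 3 * (n + 1) - 2 :=
      exists_subset_card_eq (by omega)
    set G := SimpleGraph.fromEdgeSet T with hG
    have hedge : G.edgeSet = T := by
      rw [hG, SimpleGraph.edgeSet_fromEdgeSet]
      refine sdiff_eq_left.2 (disjoint_left.2 fun e he hd => ?_)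
      exact G₀.not_isDiag_of_mem_edgeSet (hT he) hd
    have hle : G ≤ G₀ := by
      intro x y hxy
      rw [← SimpleGraph.mem_edgeSet] at hxy ⊢
      exact hT (hedge ▸ hxy)
    have hsupp : ∀ x y, G.Adj x y → x ∈ W := fun x y h => hsupp₀ x y (hle h)
    have hD : Drawable W G := hD₀.mono subset_rfl hle
    have hcard : G.edgeSet.ncard = 3 * (n + 1) - 2 := by rw [hedge, hTc]
    have hsum : ∑ v ∈ W, G.degree v = 2 * (3 * (n + 1) - 2) := by
      have h1 := G.sum_degrees_eq_twice_card_edges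
      rw [← ncard_coe_finset, SimpleGraph.coe_edgeFinset] at h1
      rw [← hcard, ← h1]
      refine Finset.sum_subset (Finset.subset_univ W) fun x _ hx => ?_
      rw [SimpleGraph.degree_eq_zero]
      intro y hy
      exact hx (hsupp x y hy)
    obtain ⟨v, hvW, hv⟩ : ∃ v ∈ W, G.degree v < 6 := by
      refine Finset.exists_lt_of_sum_lt ?_
      rw [hsum, Finset.sum_const, hn, smul_eq_mul]
      omega
    have hcommon : ∀ u ∈ G.neighborFinset v,
        3 ≤ (G.neighborFinset u ∩ G.neighborFinset v).card := by
      intro u hu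
      rw [SimpleGraph.mem_neighborFinset] at hu
      have h1 := card_edgeSet_le_contractInto G hu.symm
      have h2 := ih (W.erase v) (contractInto G u v) (by rw [Finset.card_erase_of_mem hvW, hn]; rfl)
        ⟨u, Finset.mem_erase.2 ⟨hu.ne', hsupp u v hu.symm⟩⟩
        (by
          rintro x y ⟨h1, h2, h3, h | ⟨h, h'⟩ | ⟨h, h'⟩⟩
          · exact Finset.mem_erase.2 ⟨h2, hsupp _ _ h⟩
          · exact Finset.mem_erase.2 ⟨h2, h ▸ hsupp _ _ hu.symm⟩
          · exact Finset.mem_erase.2 ⟨h2, hsupp _ _ h'⟩)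
        (hD.contract (hsupp _ _ hu.symm) hvW hu.symm)
      have h3 : (G.neighborSet u ∩ G.neighborSet v).ncard =
          (G.neighborFinset u ∩ G.neighborFinset v).card := by
        rw [← ncard_coe_finset]; simp
      omega
    rcases (G.neighborFinset v).eq_empty_or_nonempty with hemp | ⟨u, hu⟩
    · have hne : (W.erase v).Nonempty := by
        rw [Finset.nonempty_iff_ne_empty]
        intro h
        have hW1 : W = {v} := by
          rw [← Finset.insert_erase hvW, h]; rfl
        have : G.degree v = 0 := by rw [← G.card_neighborFinset_eq_degree, hemp]; rfl
        rw [hW1, Finset.sum_singleton, this] at hsum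
        omega
      have hiso : ∀ y, ¬ G.Adj v y := by
        intro y hy
        rw [← G.mem_neighborFinset, hemp] at hy
        exact absurd hy (Finset.notMem_empty _)
      have := ih (W.erase v) G (by rw [Finset.card_erase_of_mem hvW, hn]; rfl) hne
        (fun x y hxy => Finset.mem_erase.2 ⟨fun h => hiso y (h ▸ hxy), hsupp x y hxy⟩)
        (hD.mono (Finset.erase_subset _ _) le_rfl)
      omega
    have hv5 : (G.neighborFinset v).card ≤ 5 := by
      rw [G.card_neighborFinset_eq_degree]
      omega
    set N := G.neighborFinset v with hN
    have hNv : ∀ x ∈ N, G.Adj v x := fun x hx => (G.mem_neighborFinset v x).1 hx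
    have hNW : ∀ x ∈ N, x ∈ W := fun x hx => hsupp _ _ (hNv x hx).symm
    have hNcard : N.card ≤ 5 := hv5
    have hmiss : ∀ a ∈ N, ∀ x ∈ N, ∀ y ∈ N, a ≠ x → a ≠ y → x ≠ y → ¬ G.Adj a x → G.Adj a y := by
      intro a ha x hx y hy hax hay hxy h1
      by_contra h2
      have h3 := hcommon a ha
      have h4 : (G.neighborFinset a ∩ N) ⊆ ((N.erase a).erase x).erase y := by
        intro z hz
        rw [Finset.mem_inter, SimpleGraph.mem_neighborFinset] at hz
        simp only [Finset.mem_erase]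
        exact ⟨fun h => h2 (h ▸ hz.1), fun h => h1 (h ▸ hz.1), hz.1.ne', hz.2⟩
      have h5 := Finset.card_le_card h4
      rw [Finset.card_erase_of_mem, Finset.card_erase_of_mem, Finset.card_erase_of_mem ha] at h5
      · omega
      · exact Finset.mem_erase.2 ⟨hax.symm, hx⟩
      · exact Finset.mem_erase.2 ⟨hxy.symm, Finset.mem_erase.2 ⟨hay.symm, hy⟩⟩
    have hlow : N.card ≤ 4 → ∀ x ∈ N, ∀ y ∈ N, x ≠ y → G.Adj x y := by
      intro h x hx y hy hxy
      by_contra hne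
      have h3 := hcommon x hx
      have h4 : (G.neighborFinset x ∩ N) ⊆ (N.erase x).erase y := by
        intro z hz
        rw [Finset.mem_inter, SimpleGraph.mem_neighborFinset] at hz
        simp only [Finset.mem_erase]
        exact ⟨fun h => hne (h ▸ hz.1), hz.1.ne', hz.2⟩
      have h5 := Finset.card_le_card h4
      rw [Finset.card_erase_of_mem, Finset.card_erase_of_mem hx] at h5
      · omega
      · exact Finset.mem_erase.2 ⟨hxy.symm, hy⟩
    have hN4 : 4 ≤ N.card := by
      have h3 := hcommon u hu
      have h4 : (G.neighborFinset u ∩ N) ⊆ N.erase u := by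
        intro z hz
        rw [Finset.mem_inter, SimpleGraph.mem_neighborFinset] at hz
        exact Finset.mem_erase.2 ⟨hz.1.ne', hz.2⟩
      have h5 := Finset.card_le_card h4
      rw [Finset.card_erase_of_mem hu] at h5
      omega
    by_cases hcomplete : ∀ x ∈ N, ∀ y ∈ N, x ≠ y → G.Adj x y
    · obtain ⟨M, hM, hM4⟩ := Finset.exists_subset_card_eq hN4
      obtain ⟨a, b, c, d, hab, hac, had, hbc, hbd, hcd, rfl⟩ := Finset.card_eq_four.1 hM4
      have ha := hM (show a ∈ _ by simp)
      have hb := hM (show b ∈ _ by simp)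
      have hc := hM (show c ∈ _ by simp)
      have hd := hM (show d ∈ _ by simp)
      refine hD.not_K5 ![v, a, b, c, d] ?_ ?_
      · intro i
        fin_cases i
        exacts [hvW, hNW a ha, hNW b hb, hNW c hc, hNW d hd]
      · intro i j hij
        fin_cases i <;> fin_cases j <;> first
          | exact absurd hij (by decide)
          | exact hNv _ (by assumption)
          | exact hcomplete _ (by assumption) _ (by assumption) (by assumption)
    · push Not at hcomplete
      obtain ⟨a, ha, b, hb, hab, hnab⟩ := hcomplete
      have hN5 : N.card = 5 := by
        by_contra h
        exact hnab (hlow (by omega) a ha b hb hab)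
      have hM3 : ((N.erase a).erase b).card = 3 := by
        rw [Finset.card_erase_of_mem (Finset.mem_erase.2 ⟨hab.symm, hb⟩),
          Finset.card_erase_of_mem ha, hN5]
      obtain ⟨c, d, e, hc, hd, he, hcd, hce, hde, hadj⟩ : ∃ c d e,
          c ∈ (N.erase a).erase b ∧ d ∈ (N.erase a).erase b ∧ e ∈ (N.erase a).erase b ∧
          c ≠ d ∧ c ≠ e ∧ d ≠ e ∧ G.Adj d e := by
        obtain ⟨c, d, e, hcd, hce, hde, hM⟩ := Finset.card_eq_three.1 hM3
        have hmem : ∀ x ∈ ({c, d, e} : Finset V), x ∈ N := by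
          intro x hx
          rw [← hM] at hx
          exact Finset.mem_of_mem_erase (Finset.mem_of_mem_erase hx)
        rw [hM]
        by_cases h : G.Adj d e
        · exact ⟨c, d, e, by simp, by simp, by simp, hcd, hce, hde, h⟩
        · have := hmiss d (hmem _ (by simp)) e (hmem _ (by simp)) c (hmem _ (by simp)) hde
            hcd.symm hce.symm h
          exact ⟨e, d, c, by simp, by simp, by simp, hde.symm, hce.symm, hcd.symm, this⟩
      simp only [Finset.mem_erase] at hc hd he
      have hNb : ∀ x, x ≠ b ∧ x ≠ a ∧ x ∈ N → G.Adj a x ∧ G.Adj b x := by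
        rintro x ⟨h1, h2, h3⟩
        exact ⟨hmiss a ha b hb x h3 hab h2.symm h1.symm hnab,
          hmiss b hb a ha x h3 hab.symm h1.symm h2.symm (fun h => hnab h.symm)⟩
      have hac := (hNb c hc).1
      have hcW := hNW c hc.2.2
      refine (hD.contract (hNW a ha) hcW hac).not_K5 ![v, a, b, d, e] ?_ ?_
      · have hvc := (hNv c hc.2.2).ne
        intro i
        simp only [Finset.mem_erase]
        fin_cases i
        exacts [⟨hvc, hvW⟩, ⟨hac.ne, hNW a ha⟩, ⟨hc.1.symm, hNW b hb⟩,
          ⟨hcd.symm, hNW d hd.2.2⟩, ⟨hce.symm, hNW e he.2.2⟩]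
      · have hvc := (hNv c hc.2.2).ne
        have key : ∀ x y, x ≠ c → y ≠ c → G.Adj x y → (contractInto G a c).Adj x y :=
          fun x y h1 h2 h => ⟨h.ne, h1, h2, Or.inl h⟩
        have kab : (contractInto G a c).Adj a b :=
          ⟨hab, hac.ne, hc.1.symm, Or.inr (Or.inl ⟨rfl, (hNb c hc).2.symm⟩)⟩
        have kva := key v a hvc hac.ne (hNv a ha)
        have kvb := key v b hvc hc.1.symm (hNv b hb)
        have kvd := key v d hvc hcd.symm (hNv d hd.2.2)
        have kve := key v e hvc hce.symm (hNv e he.2.2)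
        have kad := key a d hac.ne hcd.symm (hNb d hd).1
        have kae := key a e hac.ne hce.symm (hNb e he).1
        have kbd := key b d hc.1.symm hcd.symm (hNb d hd).2
        have kbe := key b e hc.1.symm hce.symm (hNb e he).2
        have kde := key d e hcd.symm hce.symm hadj
        intro i j hij
        fin_cases i <;> fin_cases j <;> first
          | exact absurd hij (by decide)
          | assumption

/-- Among compact sets `A`, `B` and `K` of reals there is a shortest interval meeting all three; it
contains no point of `A ∪ B` between two points of `K`. -/
theorem exists_Icc_meeting {A B K : Set ℝ} (hA : IsCompact A) (hB : IsCompact B) (hK : IsCompact K)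
    (hA0 : A.Nonempty) (hB0 : B.Nonempty) (hK0 : K.Nonempty) (hKA : Disjoint K A)
    (hKB : Disjoint K B) :
    ∃ s t, (∃ a ∈ A, a ∈ Icc s t) ∧ (∃ b ∈ B, b ∈ Icc s t) ∧ (∃ x ∈ K, x ∈ Icc s t) ∧
      (s ∈ A ∪ B ∪ K) ∧ (t ∈ A ∪ B ∪ K) ∧
      ∀ x ∈ K, ∀ y ∈ K, s ≤ x → y ≤ t → ∀ z ∈ Icc x y, z ∉ A ∪ B := by
  obtain ⟨⟨a, b, k⟩, ⟨ha, hb, hk⟩, hmin⟩ := (hA.prod (hB.prod hK)).exists_isMinOn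
    (hA0.prod (hB0.prod hK0))
    (f := fun p : ℝ × ℝ × ℝ => max p.1 (max p.2.1 p.2.2) - min p.1 (min p.2.1 p.2.2))
    (by fun_prop)
  have hmin' : ∀ a' ∈ A, ∀ b' ∈ B, ∀ k' ∈ K, ∀ s t, a' ∈ Icc s t → b' ∈ Icc s t → k' ∈ Icc s t →
      max a (max b k) - min a (min b k) ≤ t - s := by
    intro a' ha' b' hb' k' hk' s t h1 h2 h3
    have h4 := hmin (show (a', b', k') ∈ A ×ˢ B ×ˢ K from ⟨ha', hb', hk'⟩)
    simp only [mem_ofPred_eq] at h4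
    have h5 : max a' (max b' k') ≤ t := max_le h1.2 (max_le h2.2 h3.2)
    have h6 : s ≤ min a' (min b' k') := le_min h1.1 (le_min h2.1 h3.1)
    linarith
  simp only at ha hb hk
  have ia : a ∈ Icc (min a (min b k)) (max a (max b k)) := ⟨by simp, by simp⟩
  have ib : b ∈ Icc (min a (min b k)) (max a (max b k)) := ⟨by simp, by simp⟩
  have ik : k ∈ Icc (min a (min b k)) (max a (max b k)) := ⟨by simp, by simp⟩
  refine ⟨min a (min b k), max a (max b k), ⟨a, ha, ia⟩, ⟨b, hb, ib⟩, ⟨k, hk, ik⟩, ?_, ?_, ?_⟩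
  · rcases min_choice a (min b k) with h | h <;> rw [h]
    · exact Or.inl (Or.inl ha)
    · rcases min_choice b k with h | h <;> rw [h]
      exacts [Or.inl (Or.inr hb), Or.inr hk]
  · rcases max_choice a (max b k) with h | h <;> rw [h]
    · exact Or.inl (Or.inl ha)
    · rcases max_choice b k with h | h <;> rw [h]
      exacts [Or.inl (Or.inr hb), Or.inr hk]
  · set s := min a (min b k)
    set t := max a (max b k)
    rintro x hx y hy hsx hyt z hz (hzA | hzB)
    · have h1 : x < z := lt_of_le_of_ne hz.1 fun h => disjoint_left.1 hKA hx (h ▸ hzA)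
      have h2 : z < y := lt_of_le_of_ne hz.2 fun h => disjoint_left.1 hKA hy (h ▸ hzA)
      rcases le_total b z with h | h
      · linarith [hmin' z hzA b hb x hx s z ⟨by linarith, le_rfl⟩ ⟨ib.1, h⟩ ⟨hsx, h1.le⟩]
      · linarith [hmin' z hzA b hb y hy z t ⟨le_rfl, by linarith⟩ ⟨h, ib.2⟩ ⟨h2.le, hyt⟩]
    · have h1 : x < z := lt_of_le_of_ne hz.1 fun h => disjoint_left.1 hKB hx (h ▸ hzB)
      have h2 : z < y := lt_of_le_of_ne hz.2 fun h => disjoint_left.1 hKB hy (h ▸ hzB)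
      rcases le_total a z with h | h
      · linarith [hmin' a ha z hzB x hx s z ⟨ia.1, h⟩ ⟨by linarith, le_rfl⟩ ⟨hsx, h1.le⟩]
      · linarith [hmin' a ha z hzB y hy z t ⟨h, ia.2⟩ ⟨le_rfl, by linarith⟩ ⟨h2.le, hyt⟩]

/-- Disjoint sets, one compact and one closed, are eventually more than `δ` apart. -/
theorem eventually_lt_dist {X : Type*} [PseudoMetricSpace X] {s t : Set X} (hs : IsCompact s)
    (ht : IsClosed t) (hst : Disjoint s t) :
    ∀ᶠ δ in nhdsWithin (0 : ℝ) (Ioi 0), ∀ x ∈ s, ∀ y ∈ t, δ < dist x y := by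
  obtain ⟨r, hr, h⟩ := Metric.exists_pos_forall_lt_edist hs ht hst
  filter_upwards [Ioo_mem_nhdsGT (show (0 : ℝ) < r from hr)] with δ hδ x hx y hy
  have h1 := h x hx y hy
  rw [edist_nndist, ENNReal.coe_lt_coe] at h1
  exact hδ.2.trans (by exact_mod_cast h1)

/-- A curve meeting the closed sets `r`, `b` and the compact set `K` has a subarc `E` meeting all
three sets, whose part near `K` lies in a connected set `g` avoiding `T`. -/
theorem exists_subarc {f : ℝ → Pt} (hf : Continuous f) {r b T K : Set Pt} (hr : IsClosed r)
    (hb : IsClosed b) (hT : IsClosed T) (hK : IsCompact K) (hrT : r ⊆ T) (hbT : b ⊆ T)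
    (hKT : Disjoint K T) (hfr : (f '' Icc 0 1 ∩ r).Nonempty) (hfb : (f '' Icc 0 1 ∩ b).Nonempty)
    (hfK : (f '' Icc 0 1 ∩ K).Nonempty) (hfT : f '' Icc 0 1 ∩ T ⊆ r ∪ b) :
    ∃ E g : Set Pt, E ⊆ f '' Icc 0 1 ∧ IsCompact E ∧ IsPathConnected E ∧ (E ∩ r).Nonempty ∧
      (E ∩ b).Nonempty ∧ g ⊆ E ∧ IsCompact g ∧ IsPreconnected g ∧ (g ∩ K).Nonempty ∧
      Disjoint g T ∧
      ∀ᶠ δ in nhdsWithin (0 : ℝ) (Ioi 0), ∀ x ∈ E, ∀ y ∈ K, dist x y < δ → x ∈ g := by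
  have hpre : ∀ {q : Set Pt}, IsClosed q → IsCompact (Icc (0 : ℝ) 1 ∩ f ⁻¹' q) := fun h =>
    isCompact_Icc.inter_right (h.preimage hf)
  have hne : ∀ {q : Set Pt}, (f '' Icc 0 1 ∩ q).Nonempty →
      (Icc (0 : ℝ) 1 ∩ f ⁻¹' q).Nonempty := by
    rintro q ⟨_, ⟨x, hx, rfl⟩, h⟩
    exact ⟨x, hx, h⟩
  have hdis : ∀ {q : Set Pt}, q ⊆ T →
      Disjoint (Icc (0 : ℝ) 1 ∩ f ⁻¹' K) (Icc (0 : ℝ) 1 ∩ f ⁻¹' q) := fun h =>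
    disjoint_left.2 fun x hx hx' => disjoint_left.1 hKT hx.2 (h hx'.2)
  obtain ⟨s, t, ⟨a, ha, hast⟩, ⟨b', hb', hbst⟩, ⟨k, hk, hkst⟩, hs, ht, hmid⟩ :=
    exists_Icc_meeting (hpre hr) (hpre hb) (hpre hK.isClosed) (hne hfr) (hne hfb) (hne hfK)
      (hdis hrT) (hdis hbT)
  have hs01 : s ∈ Icc (0 : ℝ) 1 := by rcases hs with (h | h) | h <;> exact h.1
  have ht01 : t ∈ Icc (0 : ℝ) 1 := by rcases ht with (h | h) | h <;> exact h.1
  have hst01 : Icc s t ⊆ Icc 0 1 := Icc_subset_Icc hs01.1 ht01.2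
  have hst : s ≤ t := hkst.1.trans hkst.2
  set Q := Icc s t ∩ f ⁻¹' K with hQ
  have hQc : IsCompact Q := isCompact_Icc.inter_right (hK.isClosed.preimage hf)
  have hQ0 : Q.Nonempty := ⟨k, hkst, hk.2⟩
  obtain ⟨u, huQ, hu⟩ := hQc.exists_isLeast hQ0
  obtain ⟨v, hvQ, hv⟩ := hQc.exists_isGreatest hQ0
  have huv : u ≤ v := hu hvQ
  have huvT : Icc u v ⊆ f ⁻¹' Tᶜ := by
    intro z hz hzT
    have hz01 : z ∈ Icc (0 : ℝ) 1 := hst01 ⟨huQ.1.1.trans hz.1, hz.2.trans hvQ.1.2⟩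
    have h1 := hmid u ⟨hst01 huQ.1, huQ.2⟩ v ⟨hst01 hvQ.1, hvQ.2⟩ huQ.1.1 hvQ.1.2 z hz
    rcases hfT ⟨mem_image_of_mem f hz01, hzT⟩ with h | h
    · exact h1 (Or.inl ⟨hz01, h⟩)
    · exact h1 (Or.inr ⟨hz01, h⟩)
  obtain ⟨η, hη, hthick⟩ := (isCompact_Icc (a := u) (b := v)).exists_cthickening_subset_open
    (hT.isOpen_compl.preimage hf) huvT
  have hηT : Icc (u - η) (v + η) ⊆ f ⁻¹' Tᶜ := by
    intro z hz
    refine hthick (Metric.mem_cthickening_of_dist_le z (max u (min z v)) η _ ?_ ?_)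
    · exact ⟨le_max_left _ _, max_le huv (min_le_right _ _)⟩
    · rw [Real.dist_eq, abs_le]
      rcases le_total z v with h | h
      · rw [min_eq_left h]
        rcases le_total u z with h' | h'
        · rw [max_eq_right h']; constructor <;> linarith
        · rw [max_eq_left h']; constructor <;> linarith [hz.1]
      · rw [min_eq_right h, max_eq_right huv]; constructor <;> linarith [hz.2]
  set I := Icc (max s (u - η)) (min t (v + η)) with hI
  have hIst : I ⊆ Icc s t := Icc_subset_Icc (le_max_left _ _) (min_le_left _ _)
  have hIη : I ⊆ Icc (u - η) (v + η) := Icc_subset_Icc (le_max_right _ _) (min_le_right _ _)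
  have huI : u ∈ I := by
    refine ⟨max_le huQ.1.1 (by linarith), le_min huQ.1.2 (by linarith)⟩
  refine ⟨f '' Icc s t, f '' I, image_mono hst01, isCompact_Icc.image hf,
    ((convex_Icc s t).isPathConnected ⟨s, left_mem_Icc.2 hst⟩).image hf,
    ⟨f a, mem_image_of_mem f hast, ha.2⟩, ⟨f b', mem_image_of_mem f hbst, hb'.2⟩,
    image_mono hIst, isCompact_Icc.image hf, isPreconnected_Icc.image f hf.continuousOn,
    ⟨f u, mem_image_of_mem f huI, huQ.2⟩, ?_, ?_⟩
  · rw [disjoint_left]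
    rintro _ ⟨z, hz, rfl⟩ h
    exact hηT (hIη hz) h
  · have h1 : IsCompact (f '' (Icc s t \ Ioo (u - η) (v + η))) :=
      (isCompact_Icc.diff isOpen_Ioo).image hf
    have h2 : Disjoint (f '' (Icc s t \ Ioo (u - η) (v + η))) K := by
      rw [disjoint_left]
      rintro _ ⟨z, hz, rfl⟩ h
      have hzQ : z ∈ Q := ⟨hz.1, h⟩
      exact hz.2 ⟨by linarith [hu hzQ], by linarith [hv hzQ]⟩
    filter_upwards [eventually_lt_dist h1 hK.isClosed h2] with δ hδ x hx y hy hxy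
    obtain ⟨z, hz, rfl⟩ := hx
    by_cases hz' : z ∈ Ioo (u - η) (v + η)
    · exact mem_image_of_mem f ⟨max_le hz.1 hz'.1.le, le_min hz.2 hz'.2.le⟩
    · exact absurd hxy (hδ _ (mem_image_of_mem f ⟨hz, hz'⟩) y hy).le.not_gt

/-- `s` is connected with respect to the relation `adj`; the empty set counts as connected. -/
def ConnOn {α : Type*} (adj : α → α → Prop) (s : Set α) : Prop :=
  ∀ A ⊆ s, A.Nonempty → (∀ a ∈ A, ∀ b ∈ s, adj a b → b ∈ A) → s ⊆ A

namespace ConnOn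

variable {α : Type*} {adj : α → α → Prop}

theorem empty : ConnOn adj ∅ := fun _ _ _ _ => empty_subset _

theorem union {s t : Set α} (hsymm : ∀ a b, adj a b → adj b a) (hs : ConnOn adj s)
    (ht : ConnOn adj t) {a b : α} (ha : a ∈ s) (hb : b ∈ t) (hab : adj a b) :
    ConnOn adj (s ∪ t) := by
  intro A hA hne hcl
  have h1 : (A ∩ s).Nonempty → s ⊆ A := fun h =>
    (hs (A ∩ s) inter_subset_right h
      fun x hx y hy hxy => ⟨hcl x hx.1 y (Or.inl hy) hxy, hy⟩).trans inter_subset_left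
  have h2 : (A ∩ t).Nonempty → t ⊆ A := fun h =>
    (ht (A ∩ t) inter_subset_right h
      fun x hx y hy hxy => ⟨hcl x hx.1 y (Or.inr hy) hxy, hy⟩).trans inter_subset_left
  obtain ⟨x, hx⟩ := hne
  rcases hA hx with hxs | hxt
  · have h3 := h1 ⟨x, hx, hxs⟩
    exact union_subset h3 (h2 ⟨b, hcl a (h3 ha) b (Or.inr hb) hab, hb⟩)
  · have h3 := h2 ⟨x, hx, hxt⟩
    exact union_subset (h1 ⟨a, hcl b (h3 hb) a (Or.inl ha) (hsymm _ _ hab), ha⟩) h3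

theorem exists_component (hsymm : ∀ a b, adj a b → adj b a) {s : Set α} {w : α} (hw : w ∈ s) :
    ∃ X ⊆ s, w ∈ X ∧ ConnOn adj X ∧ ∀ a ∈ X, ∀ b ∈ s, adj a b → b ∈ X := by
  set F : Set (Set α) := {A | A ⊆ s ∧ w ∈ A ∧ ∀ a ∈ A, ∀ b ∈ s, adj a b → b ∈ A} with hF
  have hsF : s ∈ F := ⟨subset_rfl, hw, fun _ _ _ h _ => h⟩
  have hcl : ∀ a ∈ ⋂₀ F, ∀ b ∈ s, adj a b → b ∈ ⋂₀ F := fun a ha b hb hab A hA =>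
    hA.2.2 a (ha A hA) b hb hab
  have hXs : ⋂₀ F ⊆ s := sInter_subset_of_mem hsF
  refine ⟨⋂₀ F, hXs, fun A hA => hA.2.1, ?_, hcl⟩
  intro A hA hne hAcl
  by_cases hwA : w ∈ A
  · exact sInter_subset_of_mem ⟨hA.trans hXs, hwA, fun a ha b hb hab =>
      hAcl a ha b (hcl a (hA ha) b hb hab) hab⟩
  · have h1 : ⋂₀ F ⊆ ⋂₀ F \ A := by
      refine sInter_subset_of_mem ⟨sdiff_subset.trans hXs, ⟨fun A hA => hA.2.1, hwA⟩, ?_⟩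
      exact fun a ha b hb hab => ⟨hcl a ha.1 b hb hab, fun hbA =>
        ha.2 (hAcl b hbA a ha.1 (hsymm _ _ hab))⟩
    obtain ⟨x, hx⟩ := hne
    exact absurd hx (h1 (hA hx)).2

/-- Removing a component of `D \ {v}` from `D` leaves a connected set. -/
theorem sdiff_component (hsymm : ∀ a b, adj a b → adj b a) {D X : Set α} {v : α} (hv : v ∈ D)
    (hD : ConnOn adj D) (hX : X ⊆ D \ {v}) (hcl : ∀ a ∈ X, ∀ b ∈ D \ {v}, adj a b → b ∈ X) :
    ConnOn adj (D \ X) := by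
  intro B hB hne hBcl
  have hvX : v ∉ X := fun h => (hX h).2 rfl
  by_cases hvB : v ∈ B
  · have : D ⊆ B ∪ X := by
      refine hD _ (union_subset (hB.trans sdiff_subset) (hX.trans sdiff_subset)) ⟨v, Or.inl hvB⟩ ?_
      rintro a (ha | ha) b hb hab
      · by_cases hbX : b ∈ X
        · exact Or.inr hbX
        · exact Or.inl (hBcl a ha b ⟨hb, hbX⟩ hab)
      · by_cases hbv : b = v
        · exact Or.inl (hbv ▸ hvB)
        · exact Or.inr (hcl a ha b ⟨hb, hbv⟩ hab)
    exact fun x hx => (this hx.1).resolve_right hx.2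
  · have : D ⊆ B := by
      refine hD _ (hB.trans sdiff_subset) hne fun a ha b hb hab => ?_
      refine hBcl a ha b ⟨hb, fun hbX => (hB ha).2 ?_⟩ hab
      exact hcl b hbX a ⟨(hB ha).1, fun h => hvB (h ▸ ha)⟩ (hsymm _ _ hab)
    exact absurd (this hv) hvB

end ConnOn

open Classical in
/-- A connected graph of maximum degree `Δ` containing disjoint connected sets `G k` has a connected
piece with connected complement that contains a bounded number of the `G k`, at least `L`,
and cuts at most one. -/
theorem exists_piece {α κ : Type*} {adj : α → α → Prop} (hsymm : ∀ a b, adj a b → adj b a)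
    {V : Set α} (hVfin : V.Finite) (hV : ConnOn adj V) (N : α → Finset α) {Δ L : ℕ}
    (hN : ∀ a, ∀ b ∈ V, adj a b → b ∈ N a) (hΔ : ∀ a, (N a).card ≤ Δ) (hL : 1 ≤ L)
    (G : κ → Set α) (K : Finset κ) (hGV : ∀ k ∈ K, G k ⊆ V) (hGne : ∀ k ∈ K, (G k).Nonempty)
    (hG : ∀ k ∈ K, ConnOn adj (G k)) (hGdisj : ∀ k ∈ K, ∀ l ∈ K, k ≠ l → Disjoint (G k) (G l))
    (hK : L ≤ K.card) :
    ∃ D ⊆ V, ConnOn adj D ∧ ConnOn adj (V \ D) ∧ L ≤ (K.filter fun k => G k ⊆ D).card ∧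
      (K.filter fun k => G k ⊆ D).card ≤ Δ * (L - 1) + 1 ∧
      (K.filter fun k => (G k ∩ D).Nonempty ∧ ¬ G k ⊆ D).card ≤ 1 := by
  set good : Set (Set α) := {D | D ⊆ V ∧ ConnOn adj D ∧ ConnOn adj (V \ D) ∧
    L ≤ (K.filter fun k => G k ⊆ D).card ∧
    (K.filter fun k => (G k ∩ D).Nonempty ∧ ¬ G k ⊆ D).card ≤ 1} with hgood
  have hfin : good.Finite := hVfin.finite_subsets.subset fun D hD => hD.1
  have hVgood : V ∈ good := by
    refine ⟨subset_rfl, hV, by rw [sdiff_self]; exact ConnOn.empty, ?_, ?_⟩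
    · rwa [Finset.filter_true_of_mem hGV]
    · rw [Finset.filter_false_of_mem fun k hk h => h.2 (hGV k hk)]; simp
  obtain ⟨D, hDgood, hmin⟩ := hfin.exists_minimal ⟨V, hVgood⟩
  obtain ⟨hDV, hD, hDc, hDL, hDcut⟩ := hDgood
  refine ⟨D, hDV, hD, hDc, hDL, ?_, hDcut⟩
  obtain ⟨k₁, hk₁⟩ := Finset.card_pos.1 (hL.trans hDL)
  rw [Finset.mem_filter] at hk₁
  have hDne : D.Nonempty := (hGne k₁ hk₁.1).mono hk₁.2
  obtain ⟨v, hvD, hvout, hvcut⟩ : ∃ v ∈ D, (V \ D = ∅ ∨ ∃ u ∈ V \ D, adj u v) ∧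
      ∀ k ∈ K, (G k ∩ D).Nonempty → ¬ G k ⊆ D → v ∈ G k := by
    by_cases hcut : ∃ k ∈ K, (G k ∩ D).Nonempty ∧ ¬ G k ⊆ D
    · obtain ⟨k, hk, hk1, hk2⟩ := hcut
      have h1 : ∃ a ∈ G k ∩ D, ∃ b ∈ G k, adj a b ∧ b ∉ G k ∩ D := by
        by_contra! h
        exact hk2 fun x hx => (hG k hk _ inter_subset_left hk1 h hx).2
      obtain ⟨a, ha, b, hb, hab, hbD⟩ := h1
      refine ⟨a, ha.2, Or.inr ⟨b, ⟨hGV k hk hb, fun h => hbD ⟨hb, h⟩⟩, hsymm _ _ hab⟩, ?_⟩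
      intro l hl hl1 hl2
      have := Finset.card_le_one.1 hDcut k (Finset.mem_filter.2 ⟨hk, hk1, hk2⟩) l
        (Finset.mem_filter.2 ⟨hl, hl1, hl2⟩)
      exact this ▸ ha.1
    · have h0 : ∃ v ∈ D, (V \ D = ∅ ∨ ∃ u ∈ V \ D, adj u v) := by
        by_contra! h
        obtain ⟨a, ha⟩ := hDne
        have hVD : V ⊆ D := hV D hDV ⟨a, ha⟩ fun x hx y hy hxy => by
          by_contra hyD
          exact (h x hx).2 y ⟨hy, hyD⟩ (hsymm _ _ hxy)
        exact (h a ha).1.ne_empty (sdiff_eq_empty.2 hVD)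
      obtain ⟨v, hv, h⟩ := h0
      exact ⟨v, hv, h, fun k hk h1 h2 => absurd ⟨k, hk, h1, h2⟩ hcut⟩
  have hcomp : ∀ w, ∃ X : Set α, w ∈ D \ {v} → X ⊆ D \ {v} ∧ w ∈ X ∧ ConnOn adj X ∧
      ∀ a ∈ X, ∀ b ∈ D \ {v}, adj a b → b ∈ X := by
    intro w
    by_cases hw : w ∈ D \ {v}
    · obtain ⟨X, h⟩ := ConnOn.exists_component hsymm hw
      exact ⟨X, fun _ => h⟩
    · exact ⟨∅, fun h => absurd h hw⟩
  choose X hX using hcomp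
  have hsub : ∀ w ∈ D \ {v}, ∀ k ∈ K, (G k ∩ X w).Nonempty → v ∉ G k → G k ⊆ X w := by
    intro w hw k hk hne hvk
    obtain ⟨h1, h2, h3, h4⟩ := hX w hw
    have hkD : G k ⊆ D := by
      by_contra h
      exact hvk (hvcut k hk (hne.mono (by gcongr; exact h1.trans sdiff_subset)) h)
    refine (hG k hk (G k ∩ X w) inter_subset_left hne ?_).trans inter_subset_right
    exact fun a ha b hb hab => ⟨hb, h4 a ha.2 b ⟨hkD hb, fun h => hvk (h ▸ hb)⟩ hab⟩
  have hone : ∀ s : Finset κ, (∀ k ∈ s, k ∈ K ∧ v ∈ G k) → s.card ≤ 1 := by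
    intro s hs
    refine Finset.card_le_one.2 fun k hk l hl => ?_
    by_contra hkl
    exact disjoint_left.1 (hGdisj k (hs k hk).1 l (hs l hl).1 hkl) (hs k hk).2 (hs l hl).2
  have hsmall : ∀ w ∈ D \ {v}, (K.filter fun k => G k ⊆ X w).card ≤ L - 1 := by
    intro w hw
    obtain ⟨h1, h2, h3, h4⟩ := hX w hw
    by_contra hlt
    have hgX : X w ∈ good := by
      refine ⟨(h1.trans sdiff_subset).trans hDV, h3, ?_, by omega, ?_⟩
      · have hDX := ConnOn.sdiff_component hsymm hvD hD h1 h4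
        have heq : V \ X w = (V \ D) ∪ (D \ X w) := by
          ext x
          have a1 := @hDV x
          have a2 := fun h => (@h1 x h).1
          simp only [mem_sdiff, mem_union]
          tauto
        rw [heq]
        rcases hvout with h0 | ⟨u, hu, huv⟩
        · rwa [h0, empty_union]
        · exact hDc.union hsymm hDX hu ⟨hvD, fun h => (h1 h).2 rfl⟩ huv
      · refine hone _ fun k hk => ?_
        rw [Finset.mem_filter] at hk
        refine ⟨hk.1, ?_⟩
        by_contra hvk
        exact hk.2.2 (hsub w hw k hk.1 hk.2.1 hvk)
    exact (h1 (hmin hgX (h1.trans sdiff_subset) hvD)).2 rfl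
  have hcover : ∀ x ∈ D \ {v}, ∃ w ∈ N v, w ∈ D \ {v} ∧ x ∈ X w := by
    have : D ⊆ {x | x ∈ D ∧ (x = v ∨ ∃ w ∈ N v, w ∈ D \ {v} ∧ x ∈ X w)} := by
      refine hD _ (fun x hx => hx.1) ⟨v, hvD, Or.inl rfl⟩ ?_
      rintro a ⟨haD, ha⟩ b hb hab
      refine ⟨hb, ?_⟩
      by_cases hbv : b = v
      · exact Or.inl hbv
      rcases ha with rfl | ⟨w, hw1, hw2, hw3⟩
      · exact Or.inr ⟨b, hN _ _ (hDV hb) hab, ⟨hb, hbv⟩, (hX b ⟨hb, hbv⟩).2.1⟩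
      · exact Or.inr ⟨w, hw1, hw2, (hX w hw2).2.2.2 a hw3 b ⟨hb, hbv⟩ hab⟩
    exact fun x hx => (this hx.1).2.resolve_left hx.2
  have hunion : (K.filter fun k => G k ⊆ D) ⊆
      (((N v).filter fun w => w ∈ D \ {v}).biUnion fun w => K.filter fun k => G k ⊆ X w) ∪
        K.filter fun k => v ∈ G k := by
    intro k hk
    rw [Finset.mem_filter] at hk
    by_cases hvk : v ∈ G k
    · exact Finset.mem_union_right _ (Finset.mem_filter.2 ⟨hk.1, hvk⟩)
    obtain ⟨x, hx⟩ := hGne k hk.1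
    obtain ⟨w, hw1, hw2, hw3⟩ := hcover x ⟨hk.2 hx, fun h => hvk (h ▸ hx)⟩
    refine Finset.mem_union_left _ (Finset.mem_biUnion.2 ⟨w, Finset.mem_filter.2 ⟨hw1, hw2⟩, ?_⟩)
    exact Finset.mem_filter.2 ⟨hk.1, hsub w hw2 k hk.1 ⟨x, hx, hw3⟩ hvk⟩
  calc _ ≤ _ := Finset.card_le_card hunion
    _ ≤ _ := Finset.card_union_le _ _
    _ ≤ _ := by
      gcongr
      · refine (Finset.card_biUnion_le_card_mul _ _ (L - 1) fun w hw => ?_).trans ?_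
        · exact hsmall w (Finset.mem_filter.1 hw).2
        · gcongr
          exact (Finset.card_filter_le _ _).trans (hΔ v)
      · exact hone _ fun k hk => Finset.mem_filter.1 hk

open Classical in
theorem exists_pieces {α κ : Type*} {adj : α → α → Prop} (hsymm : ∀ a b, adj a b → adj b a)
    (N : α → Finset α) {Δ L : ℕ} (hΔ : ∀ a, (N a).card ≤ Δ) (hL : 1 ≤ L) (G : κ → Set α)
    (n : ℕ) : ∀ (V : Set α) (K : Finset κ), V.Finite → ConnOn adj V →
    (∀ a, ∀ b ∈ V, adj a b → b ∈ N a) → (∀ k ∈ K, G k ⊆ V) → (∀ k ∈ K, (G k).Nonempty) →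
    (∀ k ∈ K, ConnOn adj (G k)) → (∀ k ∈ K, ∀ l ∈ K, k ≠ l → Disjoint (G k) (G l)) →
    K.card ≤ n →
    ∃ 𝒟 : Finset (Set α), (∀ D ∈ 𝒟, D ⊆ V ∧ ConnOn adj D ∧ D.Nonempty ∧
        L ≤ (K.filter fun k => G k ⊆ D).card ∧
        (K.filter fun k => G k ⊆ D).card ≤ Δ * (L - 1) + 1) ∧
      (∀ D ∈ 𝒟, ∀ D' ∈ 𝒟, D ≠ D' → Disjoint D D') ∧
      K.card ≤ ∑ D ∈ 𝒟, ((K.filter fun k => G k ⊆ D).card + 1) + (L - 1) := by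
  induction n with
  | zero =>
    intro V K _ _ _ _ _ _ _ hK
    exact ⟨∅, by simp, by simp, by omega⟩
  | succ n ih =>
    intro V K hVfin hV hN hGV hGne hG hGdisj hK
    by_cases hKL : L ≤ K.card
    swap
    · exact ⟨∅, by simp, by simp, by simp; omega⟩
    obtain ⟨D, hDV, hD, hDc, hDL, hDU, hcut⟩ :=
      exists_piece hsymm hVfin hV N hN hΔ hL G K hGV hGne hG hGdisj hKL
    set K' := K.filter fun k => Disjoint (G k) D with hK'
    have hK'K : K' ⊆ K := Finset.filter_subset _ _
    have hsplit : K.card ≤ K'.card + (K.filter fun k => G k ⊆ D).card +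
        (K.filter fun k => (G k ∩ D).Nonempty ∧ ¬ G k ⊆ D).card := by
      have : K ⊆ K' ∪ (K.filter fun k => G k ⊆ D) ∪
          (K.filter fun k => (G k ∩ D).Nonempty ∧ ¬ G k ⊆ D) := by
        intro k hk
        simp only [Finset.mem_union, Finset.mem_filter, hK', hk, true_and,
          ← not_disjoint_iff_nonempty_inter]
        tauto
      exact (Finset.card_le_card this).trans
        ((Finset.card_union_le _ _).trans (by gcongr; exact Finset.card_union_le _ _))
    have hlt : K'.card < K.card := by
      obtain ⟨k, hk⟩ := Finset.card_pos.1 (hL.trans hDL)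
      rw [Finset.mem_filter] at hk
      refine Finset.card_lt_card ⟨hK'K, fun h => ?_⟩
      obtain ⟨x, hx⟩ := hGne k hk.1
      exact disjoint_left.1 (Finset.mem_filter.1 (h hk.1)).2 hx (hk.2 hx)
    obtain ⟨𝒟, h1, h2, h3⟩ := ih (V \ D) K' (hVfin.subset sdiff_subset) hDc
      (fun a b hb => hN a b hb.1)
      (fun k hk x hx => ⟨hGV k (hK'K hk) hx,
        fun h => disjoint_left.1 (Finset.mem_filter.1 hk).2 hx h⟩)
      (fun k hk => hGne k (hK'K hk)) (fun k hk => hG k (hK'K hk))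
      (fun k hk l hl => hGdisj k (hK'K hk) l (hK'K hl)) (by omega)
    have hfil : ∀ D' ∈ 𝒟, (K'.filter fun k => G k ⊆ D') = K.filter fun k => G k ⊆ D' := by
      intro D' hD'
      ext k
      simp only [hK', Finset.mem_filter]
      refine ⟨fun h => ⟨h.1.1, h.2⟩, fun h => ⟨⟨h.1, ?_⟩, h.2⟩⟩
      exact disjoint_left.2 fun x hx hxD => ((h1 D' hD').1 (h.2 hx)).2 hxD
    have hDne : D.Nonempty := by
      obtain ⟨k, hk⟩ := Finset.card_pos.1 (hL.trans hDL)
      rw [Finset.mem_filter] at hk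
      exact (hGne k hk.1).mono hk.2
    have hdis : ∀ D' ∈ 𝒟, Disjoint D D' := fun D' hD' =>
      disjoint_left.2 fun x hx hx' => ((h1 D' hD').1 hx').2 hx
    have hnot : D ∉ 𝒟 := fun h => by
      obtain ⟨x, hx⟩ := hDne
      exact disjoint_left.1 (hdis D h) hx hx
    refine ⟨insert D 𝒟, ?_, ?_, ?_⟩
    · intro D' hD'
      rcases Finset.mem_insert.1 hD' with rfl | hD'
      · exact ⟨hDV, hD, hDne, hDL, hDU⟩
      · obtain ⟨a1, a2, a3, a4, a5⟩ := h1 D' hD'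
        rw [hfil D' hD'] at a4 a5
        exact ⟨a1.trans sdiff_subset, a2, a3, a4, a5⟩
    · intro A hA B hB hAB
      rcases Finset.mem_insert.1 hA with hA₁ | hA₁ <;> rcases Finset.mem_insert.1 hB with hB₁ | hB₁
      · exact absurd (hA₁.trans hB₁.symm) hAB
      · exact hA₁ ▸ hdis B hB₁
      · exact hB₁ ▸ (hdis A hA₁).symm
      · exact h2 A hA₁ B hB₁ hAB
    · rw [Finset.sum_insert hnot]
      have h4 : ∑ D' ∈ 𝒟, ((K'.filter fun k => G k ⊆ D').card + 1) =
          ∑ D' ∈ 𝒟, ((K.filter fun k => G k ⊆ D').card + 1) :=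
        Finset.sum_congr rfl fun D' hD' => by rw [hfil D' hD']
      omega

/-- The square of the grid of mesh `δ` containing the point `x`. -/
noncomputable def gridCell (δ : ℝ) (x : Pt) : ℤ × ℤ := (⌊x.1 / δ⌋, ⌊x.2 / δ⌋)

/-- The grid squares that share a side, or the lower left or upper right corner, with `c`. -/
def gridNeighbors (c : ℤ × ℤ) : Finset (ℤ × ℤ) :=
  {c + (1, 0), c + (0, 1), c + (1, 1), c - (1, 0), c - (0, 1), c - (1, 1)}

/-- Adjacency of half-open grid squares: the union of the two squares is connected. -/
def GridAdj (c d : ℤ × ℤ) : Prop := d ∈ gridNeighbors c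

theorem card_gridNeighbors_le (c : ℤ × ℤ) : (gridNeighbors c).card ≤ 6 := Finset.card_le_six

theorem GridAdj.symm {c d : ℤ × ℤ} (h : GridAdj c d) : GridAdj d c := by
  simp only [GridAdj, gridNeighbors, Finset.mem_insert, Finset.mem_singleton] at h ⊢
  rcases h with rfl | rfl | rfl | rfl | rfl | rfl <;> simp

theorem dist_lt_of_gridCell_eq {δ : ℝ} (hδ : 0 < δ) {x y : Pt}
    (h : gridCell δ x = gridCell δ y) : dist x y < δ := by
  rw [gridCell, gridCell, Prod.mk.injEq] at h
  have key : ∀ a b : ℝ, ⌊a / δ⌋ = ⌊b / δ⌋ → dist a b < δ := by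
    intro a b hab
    have := Int.abs_sub_lt_one_of_floor_eq_floor hab
    rwa [← sub_div, abs_div, abs_of_pos hδ, div_lt_one hδ] at this
  rw [Prod.dist_eq]
  exact max_lt (key _ _ h.1) (key _ _ h.2)

theorem eventually_floor_div (δ a : ℝ) :
    ∀ᶠ b in nhds a, ⌊b / δ⌋ = ⌊a / δ⌋ ∨ ⌊b / δ⌋ = ⌊a / δ⌋ - 1 := by
  have h1 : Filter.Tendsto (fun b : ℝ => b / δ) (nhds a) (nhds (a / δ)) :=
    (continuous_id.div_const δ).tendsto a
  have h2 := h1.eventually (Ioo_mem_nhds (a := a / δ - 1) (b := ⌊a / δ⌋ + 1) (by linarith)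
    (Int.lt_floor_add_one _))
  filter_upwards [h2] with b hb
  have h3 : ⌊b / δ⌋ < ⌊a / δ⌋ + 1 := by
    rw [Int.floor_lt]; push_cast; exact hb.2
  have h4 : ⌊a / δ⌋ - 1 ≤ ⌊b / δ⌋ := by
    rw [Int.le_floor]; push_cast; linarith [Int.floor_le (a / δ), hb.1]
  omega

/-- The grid squares met by a connected set are connected. -/
theorem IsPreconnected.connOn_gridCell (δ : ℝ) {s : Set Pt}
    (hs : IsPreconnected s) : ConnOn GridAdj (gridCell δ '' s) := by
  intro A hA hne hcl
  have hstep : ∀ x ∈ s, ∀ y ∈ s, (GridAdj (gridCell δ x) (gridCell δ y) ∨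
      gridCell δ x = gridCell δ y) → gridCell δ x ∈ A → gridCell δ y ∈ A := by
    intro x hx y hy hxy hxA
    rcases hxy with h | h
    · exact hcl _ hxA _ (mem_image_of_mem _ hy) h
    · exact h ▸ hxA
  have h : ∀ x ∈ s, ∀ y ∈ s, gridCell δ x ∈ A → gridCell δ y ∈ A := by
    intro x hx y hy
    refine hs.induction₂' (fun x y => gridCell δ x ∈ A → gridCell δ y ∈ A) ?_
      (fun x y z _ _ _ h1 h2 => h2 ∘ h1) hx hy
    intro x hx
    have h1 : ∀ᶠ y in nhds x, GridAdj (gridCell δ x) (gridCell δ y) ∨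
        gridCell δ x = gridCell δ y := by
      filter_upwards [continuous_fst.tendsto x (eventually_floor_div δ x.1),
        continuous_snd.tendsto x (eventually_floor_div δ x.2)] with y hy1 hy2
      simp only [GridAdj, gridNeighbors, Finset.mem_insert, Finset.mem_singleton, gridCell,
        Prod.mk_add_mk, Prod.mk_sub_mk, Prod.mk.injEq, mem_preimage, mem_ofPred_eq] at hy1 hy2 ⊢
      omega
    filter_upwards [mem_nhdsWithin_of_mem_nhds h1, self_mem_nhdsWithin] with y hy hys
    exact ⟨hstep x hx y hys hy, hstep y hys x hx (hy.imp GridAdj.symm Eq.symm)⟩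
  obtain ⟨a, ha⟩ := hne
  obtain ⟨x, hx, rfl⟩ := hA ha
  rintro _ ⟨y, hy, rfl⟩
  exact h x hx y hy ha

/-- The lower left corner of a grid square. -/
def gridCorner (δ : ℝ) (c : ℤ × ℤ) : Pt := (δ * c.1, δ * c.2)

theorem gridCell_gridCorner {δ : ℝ} (hδ : 0 < δ) (c : ℤ × ℤ) :
    gridCell δ (gridCorner δ c) = c := by
  simp [gridCell, gridCorner, hδ.ne']

theorem convex_gridCell {δ : ℝ} (hδ : 0 < δ) (c : ℤ × ℤ) : Convex ℝ (gridCell δ ⁻¹' {c}) := by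
  have : gridCell δ ⁻¹' {c} =
      Ico (δ * c.1) (δ * (c.1 + 1)) ×ˢ Ico (δ * c.2) (δ * (c.2 + 1)) := by
    ext x
    simp only [gridCell, mem_preimage, mem_singleton_iff, Prod.ext_iff, Int.floor_eq_iff, mem_prod,
      mem_Ico, le_div_iff₀' hδ, div_lt_iff₀' hδ]
  rw [this]
  exact (convex_Ico _ _).prod (convex_Ico _ _)

theorem joinedIn_gridCorner {δ : ℝ} (hδ : 0 < δ) (c : ℤ × ℤ) {d : ℤ × ℤ}
    (hd : d = (1, 0) ∨ d = (0, 1) ∨ d = (1, 1)) {U : Set Pt} (hc : gridCell δ ⁻¹' {c} ⊆ U)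
    (hcd : gridCell δ ⁻¹' {c + d} ⊆ U) : JoinedIn U (gridCorner δ c) (gridCorner δ (c + d)) := by
  refine JoinedIn.of_segment_subset fun x hx => ?_
  rw [segment_eq_image_lineMap] at hx
  obtain ⟨θ, hθ, rfl⟩ := hx
  have h01 : (0 : ℤ) ≤ d.1 ∧ d.1 ≤ 1 ∧ 0 ≤ d.2 ∧ d.2 ≤ 1 := by
    rcases hd with rfl | rfl | rfl <;> simp
  rcases hθ.2.lt_or_eq with h1 | rfl
  · apply hc
    have key : ∀ i j : ℤ, 0 ≤ j → j ≤ 1 →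
        ⌊AffineMap.lineMap (k := ℝ) (δ * (i : ℝ)) (δ * ((i + j : ℤ) : ℝ)) θ / δ⌋ = i := by
      intro i j hj0 hj1
      have : AffineMap.lineMap (k := ℝ) (δ * (i : ℝ)) (δ * ((i + j : ℤ) : ℝ)) θ / δ = i + θ * j := by
        rw [AffineMap.lineMap_apply]
        simp
        field_simp
        ring
      rw [this, Int.floor_eq_iff]
      have hj0' : (0 : ℝ) ≤ j := by exact_mod_cast hj0
      have hj1' : (j : ℝ) ≤ 1 := by exact_mod_cast hj1
      have := mul_nonneg hθ.1 hj0'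
      have := mul_le_mul_of_nonneg_left hj1' hθ.1
      constructor <;> linarith
    have e1 := key c.1 d.1 h01.1 h01.2.1
    have e2 := key c.2 d.2 h01.2.2.1 h01.2.2.2
    simp only [mem_preimage, mem_singleton_iff]
    refine Prod.ext ?_ ?_
    · simpa [gridCell, gridCorner, AffineMap.lineMap_apply] using e1
    · simpa [gridCell, gridCorner, AffineMap.lineMap_apply] using e2
  · rw [AffineMap.lineMap_apply_one]
    exact hcd (gridCell_gridCorner hδ _)

/-- The union of a connected set of grid squares is path-connected. -/
theorem ConnOn.isPathConnected {δ : ℝ} (hδ : 0 < δ) {D : Set (ℤ × ℤ)} (hD : ConnOn GridAdj D)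
    (hne : D.Nonempty) : IsPathConnected (gridCell δ ⁻¹' D) := by
  obtain ⟨a, ha⟩ := hne
  have hsub : ∀ c ∈ D, gridCell δ ⁻¹' {c} ⊆ gridCell δ ⁻¹' D := fun c hc =>
    preimage_mono (singleton_subset_iff.2 hc)
  have hadj : ∀ c ∈ D, ∀ d ∈ D, GridAdj c d →
      JoinedIn (gridCell δ ⁻¹' D) (gridCorner δ c) (gridCorner δ d) := by
    intro c hc d hd hcd
    have key : ∀ c ∈ D, ∀ d ∈ D, (d - c = (1, 0) ∨ d - c = (0, 1) ∨ d - c = (1, 1)) →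
        JoinedIn (gridCell δ ⁻¹' D) (gridCorner δ c) (gridCorner δ d) := by
      intro c hc d hd h
      have := joinedIn_gridCorner hδ c h (hsub c hc) (by rw [add_sub_cancel]; exact hsub d hd)
      rwa [add_sub_cancel] at this
    simp only [GridAdj, gridNeighbors, Finset.mem_insert, Finset.mem_singleton] at hcd
    rcases hcd with h | h | h | h | h | h
    · exact key c hc d hd (by simp [h])
    · exact key c hc d hd (by simp [h])
    · exact key c hc d hd (by simp [h])
    · exact (key d hd c hc (by simp [h])).symm
    · exact (key d hd c hc (by simp [h])).symm
    · exact (key d hd c hc (by simp [h])).symm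
  have hall : D ⊆ {c | c ∈ D ∧ JoinedIn (gridCell δ ⁻¹' D) (gridCorner δ a) (gridCorner δ c)} := by
    refine hD _ (fun c hc => hc.1) ⟨a, ha, JoinedIn.refl ?_⟩ ?_
    · exact hsub a ha (gridCell_gridCorner hδ a)
    · exact fun c hc d hd hcd => ⟨hd, hc.2.trans (hadj c hc.1 d hd hcd)⟩
  refine ⟨gridCorner δ a, hsub a ha (gridCell_gridCorner hδ a), fun {x} hx => ?_⟩
  refine (hall hx).2.trans (JoinedIn.mono ?_ (hsub _ hx))
  exact ((convex_gridCell hδ _).isPathConnected ⟨x, rfl⟩).joinedIn _ (gridCell_gridCorner hδ _) _ rfl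

theorem finite_gridCell_image {δ : ℝ} (hδ : 0 < δ) {s : Set Pt} (hs : Bornology.IsBounded s) :
    (gridCell δ '' s).Finite := by
  obtain ⟨R, hR⟩ := hs.exists_norm_le
  refine (finite_Icc ((⌊-R / δ⌋, ⌊-R / δ⌋) : ℤ × ℤ) (⌊R / δ⌋, ⌊R / δ⌋)).subset ?_
  rintro _ ⟨x, hx, rfl⟩
  have h1 : |x.1| ≤ R := (norm_fst_le x).trans (hR x hx)
  have h2 : |x.2| ≤ R := (norm_snd_le x).trans (hR x hx)
  rw [abs_le] at h1 h2
  refine ⟨⟨?_, ?_⟩, ⟨?_, ?_⟩⟩ <;> exact Int.floor_le_floor (by gcongr; linarith)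

/-- A family of disjoint curves joining distinct pairs of disjoint sets in the plane has at most
linear size. -/
theorem card_le_of_drawing {ρ κ : Type*} [Fintype ρ] [Fintype κ] (X : ρ → Set Pt)
    (E : κ → Set Pt) (p q : κ → ρ) (hX : ∀ v, IsPathConnected (X v))
    (hXd : ∀ u v, u ≠ v → Disjoint (X u) (X v)) (hE : ∀ k, IsPathConnected (E k))
    (hEd : ∀ k l, k ≠ l → Disjoint (E k) (E l)) (hp : ∀ k, (E k ∩ X (p k)).Nonempty)
    (hq : ∀ k, (E k ∩ X (q k)).Nonempty) (hpq : ∀ k, p k ≠ q k)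
    (hother : ∀ k w, w ≠ p k → w ≠ q k → Disjoint (E k) (X w))
    (hinj : Function.Injective fun k => s(p k, q k)) :
    Fintype.card κ ≤ 3 * Fintype.card ρ := by
  classical
  rcases isEmpty_or_nonempty ρ with hρ | hρ
  · have : IsEmpty κ := ⟨fun k => hρ.elim (p k)⟩
    simp
  set G : SimpleGraph ρ := SimpleGraph.fromEdgeSet (range fun k => s(p k, q k)) with hG
  have hedge : G.edgeSet = range fun k => s(p k, q k) := by
    rw [hG, SimpleGraph.edgeSet_fromEdgeSet]
    refine sdiff_eq_left.2 (disjoint_left.2 ?_)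
    rintro _ ⟨k, rfl⟩ hd
    exact hpq k hd
  have hcard : G.edgeSet.ncard = Fintype.card κ := by
    rw [hedge, ← Nat.card_coe_set_eq, Nat.card_range_of_injective hinj, Nat.card_eq_fintype_card]
  have hrep : ∀ x y, ∃ F : Set Pt, G.Adj x y → ∃ k, s(p k, q k) = s(x, y) ∧ F = E k := by
    intro x y
    by_cases h : G.Adj x y
    · obtain ⟨k, hk⟩ := ((SimpleGraph.fromEdgeSet_adj _).1 h).1
      exact ⟨E k, fun _ => ⟨k, hk, rfl⟩⟩
    · exact ⟨∅, fun h' => absurd h' h⟩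
  choose F hF using hrep
  have hD : Drawable Finset.univ G := by
    refine ⟨X, F, fun v _ => hX v, fun u _ v _ => hXd u v, ?_, ?_, ?_, ?_, ?_⟩
    · intro u _ v _ h
      obtain ⟨k, -, h2⟩ := hF u v h
      exact h2 ▸ hE k
    · intro u _ v _ h
      obtain ⟨k, h1, h2⟩ := hF u v h
      rw [h2, inter_comm]
      rcases Sym2.eq_iff.1 h1 with ⟨rfl, rfl⟩ | ⟨rfl, rfl⟩
      exacts [hp k, hq k]
    · intro u _ v _ h
      obtain ⟨k, h1, h2⟩ := hF u v h
      rw [h2]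
      rcases Sym2.eq_iff.1 h1 with ⟨rfl, rfl⟩ | ⟨rfl, rfl⟩
      exacts [hq k, hp k]
    · intro u _ v _ h w _ hu hv
      obtain ⟨k, h1, h2⟩ := hF u v h
      rw [h2]
      rcases Sym2.eq_iff.1 h1 with ⟨rfl, rfl⟩ | ⟨rfl, rfl⟩
      exacts [hother k w hu hv, hother k w hv hu]
    · intro u _ v _ h w _ z _ h' n1 n2 n3 n4
      obtain ⟨k, h1, h2⟩ := hF u v h
      obtain ⟨l, h3, h4⟩ := hF w z h'
      rw [h2, h4]
      refine hEd k l fun hkl => ?_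
      subst hkl
      rcases Sym2.eq_iff.1 (h1.symm.trans h3) with ⟨h, -⟩ | ⟨h, -⟩
      exacts [n1 h, n2 h]
  have := Drawable.card_edgeSet_le _ Finset.univ G rfl Finset.univ_nonempty
    (fun x _ _ => Finset.mem_univ x) hD
  rw [hcard, Finset.card_univ] at this
  omega

/-- The number of pairs consisting of a block `U j` and a set `X r` that are joined by some `E k`
with `k ∈ J j` is at most linear. -/
theorem sum_card_image_le {ι ρ κ : Type*} [Fintype ι] [Fintype ρ] [DecidableEq ρ]
    (U : ι → Set Pt) (X : ρ → Set Pt) (E : κ → Set Pt) (J : ι → Finset κ) (p : κ → ρ)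
    (hU : ∀ j, IsPathConnected (U j)) (hUd : ∀ i j, i ≠ j → Disjoint (U i) (U j))
    (hX : ∀ r, IsPathConnected (X r)) (hXd : ∀ u v, u ≠ v → Disjoint (X u) (X v))
    (hUX : ∀ j r, Disjoint (U j) (X r)) (hE : ∀ k, IsPathConnected (E k))
    (hEd : ∀ k l, k ≠ l → Disjoint (E k) (E l)) (hEX : ∀ k, (E k ∩ X (p k)).Nonempty)
    (hEX_other : ∀ k r, r ≠ p k → Disjoint (E k) (X r))
    (hEU : ∀ j, ∀ k ∈ J j, (E k ∩ U j).Nonempty)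
    (hEU_other : ∀ i j, i ≠ j → ∀ k ∈ J i, Disjoint (E k) (U j)) :
    ∑ j, ((J j).image p).card ≤ 3 * (Fintype.card ι + Fintype.card ρ) := by
  have hrep : ∀ a : Σ j : ι, {r // r ∈ (J j).image p}, ∃ k ∈ J a.1, p k = a.2.1 := fun a =>
    Finset.mem_image.1 a.2.2
  choose e he hep using hrep
  have hext : ∀ a b, a.1 = b.1 → e a = e b → a = b := by
    rintro ⟨i, r, hr⟩ ⟨j, s, hs⟩ rfl h
    have h1 := hep ⟨i, r, hr⟩
    rw [h, hep] at h1
    simp only at h1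
    subst h1
    rfl
  have hinj : ∀ a b, a ≠ b → e a ≠ e b := by
    intro a b hab h
    refine hab (hext a b ?_ h)
    by_contra hne
    obtain ⟨x, hx⟩ := hEU b.1 (e b) (he b)
    exact disjoint_left.1 (hEU_other a.1 b.1 hne (e a) (he a)) (h ▸ hx.1) hx.2
  have h := card_le_of_drawing (ρ := ι ⊕ ρ) (Sum.elim U X) (fun a => E (e a))
    (fun a => Sum.inl a.1) (fun a => Sum.inr a.2.1) ?_ ?_ (fun a => hE _)
    (fun a b hab => hEd _ _ (hinj a b hab)) (fun a => hEU _ _ (he a)) ?_ (fun a => by simp) ?_ ?_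
  · simpa only [Fintype.card_sigma, Fintype.card_coe, Fintype.card_sum] using h
  · rintro (j | r)
    exacts [hU j, hX r]
  · rintro (i | r) (j | s) h
    · exact hUd i j fun h' => h (h' ▸ rfl)
    · exact hUX i s
    · exact (hUX j r).symm
    · exact hXd r s fun h' => h (h' ▸ rfl)
  · intro a
    have := hEX (e a)
    rwa [hep] at this
  · rintro a (j | r) h1 h2
    · exact hEU_other a.1 j (fun h => h1 (h ▸ rfl)) _ (he a)
    · refine hEX_other _ r fun h => h2 ?_
      rw [h, hep]
  · rintro ⟨i, r, hr⟩ ⟨j, s, hs⟩ h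
    simp only [Sym2.eq_iff, Sum.inl.injEq, Sum.inr.injEq, reduceCtorEq, false_and, or_false] at h
    obtain ⟨rfl, rfl⟩ := h
    rfl

/-- The part of the plane covered by disjoint arcs `E k` attached to the connected set `K` can be
cut into blocks each containing the attachments of a bounded number of the arcs. -/
theorem exists_blocks {κ : Type*} [Fintype κ] {T K : Set Pt} (hT : IsClosed T)
    (hK : IsCompact K) (hKc : IsConnected K) (hKT : Disjoint K T) (E g : κ → Set Pt)
    (hE : ∀ k, IsCompact (E k)) (hEd : ∀ k l, k ≠ l → Disjoint (E k) (E l))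
    (hgE : ∀ k, g k ⊆ E k) (hg : ∀ k, IsCompact (g k)) (hgc : ∀ k, IsPreconnected (g k))
    (hgK : ∀ k, (g k ∩ K).Nonempty) (hgT : ∀ k, Disjoint (g k) T)
    (hEK : ∀ k, ∀ᶠ δ in nhdsWithin (0 : ℝ) (Ioi 0), ∀ x ∈ E k, ∀ y ∈ K, dist x y < δ → x ∈ g k)
    {L : ℕ} (hL : 1 ≤ L) :
    ∃ (ι : Type) (_ : Fintype ι) (U : ι → Set Pt) (J : ι → Finset κ),
      (∀ j, IsPathConnected (U j)) ∧ (∀ j, Disjoint (U j) T) ∧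
      (∀ i j, i ≠ j → Disjoint (U i) (U j)) ∧ (∀ j, ∀ k ∈ J j, (E k ∩ U j).Nonempty) ∧
      (∀ i j, i ≠ j → ∀ k ∈ J i, Disjoint (E k) (U j)) ∧
      (∀ j, L ≤ (J j).card ∧ (J j).card ≤ 6 * (L - 1) + 1) ∧
      Fintype.card κ ≤ ∑ j, ((J j).card + 1) + (L - 1) := by
  classical
  set K₁ := K ∪ ⋃ k, g k with hK₁
  have hK₁c : IsCompact K₁ := hK.union (isCompact_iUnion hg)
  have hK₁T : Disjoint K₁ T := by
    rw [hK₁, disjoint_union_left, disjoint_iUnion_left]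
    exact ⟨hKT, hgT⟩
  have hK₁p : IsPreconnected K₁ := by
    obtain ⟨x, hx⟩ := hKc.nonempty
    refine isPreconnected_of_forall x ?_
    rintro y (hy | hy)
    · exact ⟨K, subset_union_left, hx, hy, hKc.isPreconnected⟩
    · obtain ⟨k, hk⟩ := mem_iUnion.1 hy
      refine ⟨K ∪ g k, union_subset_union_right _ (subset_iUnion g k), Or.inl hx, Or.inr hk, ?_⟩
      obtain ⟨z, hz⟩ := hgK k
      exact hKc.isPreconnected.union z hz.2 hz.1 (hgc k)
  have hev1 := eventually_lt_dist hK₁c hT hK₁T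
  have hev2 : ∀ᶠ δ in nhdsWithin (0 : ℝ) (Ioi 0), ∀ k l, k ≠ l → ∀ x ∈ E k, ∀ y ∈ E l,
      δ < dist x y := by
    simp only [Filter.eventually_all]
    exact fun k l hkl => eventually_lt_dist (hE k) (hE l).isClosed (hEd k l hkl)
  obtain ⟨δ, h1, h2, h3, hδ⟩ := (hev1.and (hev2.and ((Filter.eventually_all.2 hEK).and
    self_mem_nhdsWithin))).exists
  have hδ : 0 < δ := hδ
  have hGV : ∀ k, gridCell δ '' g k ⊆ gridCell δ '' K₁ := fun k =>
    image_mono ((subset_iUnion g k).trans subset_union_right)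
  obtain ⟨𝒟, hD, hDd, hcard⟩ := exists_pieces (adj := GridAdj) (fun _ _ => GridAdj.symm)
    gridNeighbors card_gridNeighbors_le hL (fun k => gridCell δ '' g k) (Fintype.card κ)
    (gridCell δ '' K₁) Finset.univ (finite_gridCell_image hδ hK₁c.isBounded)
    (hK₁p.connOn_gridCell δ) (fun _ _ _ h => h) (fun k _ => hGV k)
    (fun k _ => ((hgK k).mono inter_subset_left).image _) (fun k _ => (hgc k).connOn_gridCell δ)
    (by
      intro k _ l _ hkl
      rw [disjoint_left]
      rintro _ ⟨x, hx, rfl⟩ ⟨y, hy, hxy⟩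
      have a1 := h2 l k hkl.symm y (hgE l hy) x (hgE k hx)
      exact a1.not_gt (dist_lt_of_gridCell_eq hδ hxy))
    le_rfl
  refine ⟨{D // D ∈ 𝒟}, inferInstance, fun D => gridCell δ ⁻¹' D.1,
    fun D => Finset.univ.filter fun k => gridCell δ '' g k ⊆ D.1, ?_, ?_, ?_, ?_, ?_, ?_, ?_⟩
  · exact fun D => (hD D.1 D.2).2.1.isPathConnected hδ (hD D.1 D.2).2.2.1
  · intro D
    rw [disjoint_left]
    intro x hx hxT
    obtain ⟨y, hy, hxy⟩ := (hD D.1 D.2).1 hx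
    exact (h1 y hy x hxT).not_gt (dist_lt_of_gridCell_eq hδ hxy)
  · intro D D' hne
    exact (hDd D.1 D.2 D'.1 D'.2 fun h => hne (Subtype.ext h)).preimage _
  · intro D k hk
    obtain ⟨x, hx⟩ := hgK k
    exact ⟨x, hgE k hx.1, (Finset.mem_filter.1 hk).2 (mem_image_of_mem _ hx.1)⟩
  · intro D D' hne k hk
    have hkD := (Finset.mem_filter.1 hk).2
    have hDD := hDd D.1 D.2 D'.1 D'.2 fun h => hne (Subtype.ext h)
    rw [disjoint_left]
    intro x hx hxD
    have hnot : gridCell δ x ∉ gridCell δ '' g k := fun h => disjoint_left.1 hDD (hkD h) hxD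
    obtain ⟨y, hy | hy, hxy⟩ := (hD D'.1 D'.2).1 hxD
    · have := h3 k x hx y hy (dist_lt_of_gridCell_eq hδ hxy.symm)
      exact hnot (mem_image_of_mem _ this)
    · obtain ⟨l, hl⟩ := mem_iUnion.1 hy
      by_cases hkl : k = l
      · subst hkl
        exact hnot ⟨y, hl, hxy⟩
      · exact (h2 k l hkl x hx y (hgE l hl)).not_gt (dist_lt_of_gridCell_eq hδ hxy.symm)
  · exact fun D => (hD D.1 D.2).2.2.2
  · rw [Finset.sum_coe_sort 𝒟 fun D =>
      ((Finset.univ.filter fun k => gridCell δ '' g k ⊆ D).card + 1)]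
    simpa using hcard

/-- A family of disjoint curves, all attached to a connected set `K`, and each joining a member of
one family of disjoint sets to a member of another, has at most linear size. -/
theorem card_le_of_bicolored {κ ρ σ : Type*} [Fintype κ] [Fintype ρ] [Fintype σ]
    (X : ρ → Set Pt) (Y : σ → Set Pt) (f : κ → ℝ → Pt) (p : κ → ρ) (q : κ → σ) {K : Set Pt}
    (hX : ∀ r, IsPathConnected (X r)) (hXc : ∀ r, IsClosed (X r))
    (hXd : ∀ u v, u ≠ v → Disjoint (X u) (X v))
    (hY : ∀ r, IsPathConnected (Y r)) (hYc : ∀ r, IsClosed (Y r))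
    (hYd : ∀ u v, u ≠ v → Disjoint (Y u) (Y v)) (hf : ∀ k, Continuous (f k))
    (hfd : ∀ k l, k ≠ l → Disjoint (f k '' Icc 0 1) (f l '' Icc 0 1))
    (hfX : ∀ k, (f k '' Icc 0 1 ∩ X (p k)).Nonempty)
    (hfX_other : ∀ k r, r ≠ p k → Disjoint (f k '' Icc 0 1) (X r))
    (hfY : ∀ k, (f k '' Icc 0 1 ∩ Y (q k)).Nonempty)
    (hfY_other : ∀ k r, r ≠ q k → Disjoint (f k '' Icc 0 1) (Y r))
    (hK : IsCompact K) (hKc : IsConnected K) (hKX : ∀ r, Disjoint K (X r))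
    (hKY : ∀ r, Disjoint K (Y r)) (hfK : ∀ k, (f k '' Icc 0 1 ∩ K).Nonempty)
    (hinj : Function.Injective fun k => (p k, q k)) :
    Fintype.card κ ≤ 27 * (Fintype.card ρ + Fintype.card σ) + 12 := by
  classical
  set T := (⋃ r, X r) ∪ ⋃ r, Y r with hT
  have hTc : IsClosed T := (isClosed_iUnion_of_finite hXc).union (isClosed_iUnion_of_finite hYc)
  have hXT : ∀ r, X r ⊆ T := fun r => (subset_iUnion X r).trans subset_union_left
  have hYT : ∀ r, Y r ⊆ T := fun r => (subset_iUnion Y r).trans subset_union_right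
  have hKT : Disjoint K T := by
    rw [hT, disjoint_union_right, disjoint_iUnion_right, disjoint_iUnion_right]
    exact ⟨hKX, hKY⟩
  have hfT : ∀ k, f k '' Icc 0 1 ∩ T ⊆ X (p k) ∪ Y (q k) := by
    rintro k x ⟨hx, hxT | hxT⟩ <;> obtain ⟨r, hr⟩ := mem_iUnion.1 hxT
    · left
      by_cases h : r = p k
      · exact h ▸ hr
      · exact absurd hr (disjoint_left.1 (hfX_other k r h) hx)
    · right
      by_cases h : r = q k
      · exact h ▸ hr
      · exact absurd hr (disjoint_left.1 (hfY_other k r h) hx)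
  choose E g hEf hE hEp hEX hEY hgE hg hgc hgK hgT hEK using fun k =>
    exists_subarc (hf k) (hXc (p k)) (hYc (q k)) hTc hK (hXT _) (hYT _) hKT (hfX k) (hfY k)
      (hfK k) (hfT k)
  have hEd : ∀ k l, k ≠ l → Disjoint (E k) (E l) := fun k l h =>
    (hfd k l h).mono (hEf k) (hEf l)
  obtain ⟨ι, _, U, J, hU, hUT, hUd, hEU, hEU_other, hJ, hcard⟩ :=
    exists_blocks hTc hK hKc hKT E g hE hEd hgE hg hgc hgK hgT hEK (L := 13) (by norm_num)
  have hx := sum_card_image_le U X E J p hU hUd hX hXd (fun j r => (hUT j).mono_right (hXT r)) hEp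
    hEd hEX (fun k r h => (hfX_other k r h).mono_left (hEf k)) hEU hEU_other
  have hy := sum_card_image_le U Y E J q hU hUd hY hYd (fun j r => (hUT j).mono_right (hYT r)) hEp
    hEd hEY (fun k r h => (hfY_other k r h).mono_left (hEf k)) hEU hEU_other
  have hprod : ∀ j, (J j).card ≤ ((J j).image p).card * ((J j).image q).card := by
    intro j
    rw [← Finset.card_product, ← Finset.card_image_of_injective (J j) hinj]
    refine Finset.card_le_card fun a ha => ?_
    obtain ⟨k, hk, rfl⟩ := Finset.mem_image.1 ha
    exact Finset.mem_product.2 ⟨Finset.mem_image_of_mem p hk, Finset.mem_image_of_mem q hk⟩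
  have harith : ∀ s x y : ℕ, 13 ≤ s → s ≤ 73 → s ≤ x * y → s + 1 + 54 ≤ 9 * x + 9 * y := by
    intro s x y h1 h2 h3
    by_contra! h4
    have h5 : (s : ℤ) ≤ x * y := by exact_mod_cast h3
    have h6 : (9 : ℤ) * (x + y) < s + 55 := by exact_mod_cast (by omega : 9 * (x + y) < s + 55)
    have h7 : (x : ℤ) + y ≤ 14 := by omega
    have h8 : 4 * ((x : ℤ) * y) ≤ (x + y) ^ 2 := by nlinarith [sq_nonneg ((x : ℤ) - y)]
    have h9 : (0 : ℤ) ≤ x + y := by positivity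
    generalize (x : ℤ) + y = w at *
    interval_cases w <;> omega
  have hsum : ∑ j, ((J j).card + 1 + 54) ≤
      ∑ j, (9 * ((J j).image p).card + 9 * ((J j).image q).card) :=
    Finset.sum_le_sum fun j _ => harith _ _ _ (hJ j).1 (hJ j).2 (hprod j)
  rw [Finset.sum_add_distrib, Finset.sum_add_distrib (f := fun j => 9 * ((J j).image p).card),
    ← Finset.mul_sum, ← Finset.mul_sum, Finset.sum_const, Finset.card_univ, smul_eq_mul] at hsum
  omega

theorem IsCurve.exists_continuous {s : Set Pt} (h : IsCurve s) :
    ∃ f : ℝ → Pt, Continuous f ∧ s = f '' Icc 0 1 := by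
  obtain ⟨f, hf, -, rfl⟩ := h
  refine ⟨IccExtend zero_le_one ((Icc (0 : ℝ) 1).domRestrict f), hf.domRestrict.Icc_extend', ?_⟩
  refine image_congr fun x hx => ?_
  rw [IccExtend_of_mem _ _ hx]
  rfl

theorem IsCurve.isPathConnected {s : Set Pt} (h : IsCurve s) : IsPathConnected s := by
  obtain ⟨f, hf, rfl⟩ := h.exists_continuous
  exact ((convex_Icc 0 1).isPathConnected ⟨0, by simp⟩).image hf

theorem IsCurve.isClosed {s : Set Pt} (h : IsCurve s) : IsClosed s := by
  obtain ⟨f, hf, rfl⟩ := h.exists_continuous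
  exact (isCompact_Icc.image hf).isClosed

/-- A grounded family is attached to a compact connected set avoiding `⋃ S`. -/
theorem Grounded.exists_isCompact {ι κ : Type*} [Finite ι] [Finite κ] {C : ι → Set Pt}
    {S : κ → Set Pt} (h : Grounded C S) (hS : ∀ k, IsClosed (S k)) :
    ∃ K : Set Pt, IsCompact K ∧ IsConnected K ∧ (∀ k, Disjoint K (S k)) ∧
      ∀ i, (C i ∩ K).Nonempty := by
  obtain ⟨x, hx, hC⟩ := h
  set F := connectedComponentIn (⋃ k, S k)ᶜ x with hF
  have hFo : IsOpen F := (isClosed_iUnion_of_finite hS).isOpen_compl.connectedComponentIn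
  have hFp : IsPathConnected F :=
    (hFo.isConnected_iff_isPathConnected).1 (isConnected_connectedComponentIn_iff.2 hx)
  have hFS : F ⊆ (⋃ k, S k)ᶜ := connectedComponentIn_subset _ _
  have hxF : x ∈ F := mem_connectedComponentIn hx
  choose P hPF hPC using hC
  choose γ hγ using fun i => hFp.joinedIn x hxF (P i) (hPF i)
  refine ⟨{x} ∪ ⋃ i, range (γ i), isCompact_singleton.union
    (isCompact_iUnion fun i => isCompact_range (γ i).continuous), ⟨⟨x, Or.inl rfl⟩, ?_⟩, ?_, ?_⟩
  · refine isPreconnected_of_forall x ?_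
    rintro y (rfl | hy)
    · exact ⟨{y}, subset_union_left, rfl, rfl, isPreconnected_singleton⟩
    · obtain ⟨i, hi⟩ := mem_iUnion.1 hy
      exact ⟨range (γ i), (subset_iUnion (fun i => range (γ i)) i).trans subset_union_right,
        ⟨0, (γ i).source⟩, hi, isPreconnected_range (γ i).continuous⟩
  · intro k
    rw [disjoint_left]
    intro y hy hyk
    have hyF : y ∈ F := by
      rcases hy with rfl | hy
      · exact hxF
      · obtain ⟨i, t, rfl⟩ := mem_iUnion.1 hy
        exact hγ i t
    exact hFS hyF (mem_iUnion.2 ⟨k, hyk⟩)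
  · exact fun i => ⟨P i, hPC i, Or.inr (mem_iUnion.2 ⟨i, 1, (γ i).target⟩)⟩

theorem stmt2 (n m : ℕ) (S : Fin n → Set Pt) (color : Fin n → Bool) (C : Fin m → Set Pt)
    (hScurve : ∀ i, IsPolygonalCurve (S i))
    (hCcurve : ∀ k, IsPolygonalCurve (C k))
    (hSinj : Function.Injective S)
    -- no two curves of the same color intersect
    (hsame : ∀ i j : Fin n, i ≠ j → color i = color j → Disjoint (S i) (S j))
    -- every pair of curves intersects in finitely many points
    (hSSfin : ∀ i j : Fin n, i ≠ j → (S i ∩ S j).Finite)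
    (hSCfin : ∀ i k, (S i ∩ C k).Finite)
    -- no point belongs to more than two of the curves considered
    (htriple : ∀ p : Pt, ({x : Fin n ⊕ Fin m | p ∈ Sum.elim S C x}).encard ≤ 2)
    -- the curves of `C` are pairwise disjoint
    (hCdisj : ∀ k l : Fin m, k ≠ l → Disjoint (C k) (C l))
    -- `C` is grounded with respect to `S`
    (hground : Grounded C S)
    -- each `c ∈ C` intersects exactly two members of `S`
    (htwo : ∀ k : Fin m, ∃ i j : Fin n, i ≠ j ∧ (C k ∩ S i).Nonempty ∧ (C k ∩ S j).Nonempty ∧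
      ∀ l : Fin n, (C k ∩ S l).Nonempty → l = i ∨ l = j)
    -- distinct members of `C` intersect distinct pairs of members of `S`
    (hdist : ∀ k l : Fin m, k ≠ l →
      {i : Fin n | (C k ∩ S i).Nonempty} ≠ {i : Fin n | (C l ∩ S i).Nonempty}) :
    m ≤ 33 * n - 25 := by
  classical
  have htwo' : ∀ k : Fin m, ∃ i j : Fin n, i ≠ j ∧ (C k ∩ S i).Nonempty ∧ (C k ∩ S j).Nonempty ∧
      (∀ l : Fin n, (C k ∩ S l).Nonempty → l = i ∨ l = j) ∧
      (color i ≠ color j → color i = true ∧ color j = false) := by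
    intro k
    obtain ⟨i, j, hij, hi, hj, hl⟩ := htwo k
    rcases hci : color i with _ | _ <;> rcases hcj : color j with _ | _
    · exact ⟨i, j, hij, hi, hj, hl, by simp [hci, hcj]⟩
    · exact ⟨j, i, hij.symm, hj, hi, fun l h => (hl l h).symm, by simp [hci, hcj]⟩
    · exact ⟨i, j, hij, hi, hj, hl, by simp [hci, hcj]⟩
    · exact ⟨i, j, hij, hi, hj, hl, by simp [hci, hcj]⟩
  choose p q hpq hp hq honly hcol using htwo'
  have hset : ∀ k, {i : Fin n | (C k ∩ S i).Nonempty} = {p k, q k} := by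
    intro k
    ext i
    refine ⟨honly k i, ?_⟩
    rintro (rfl | rfl)
    exacts [hp k, hq k]
  have hinj : Function.Injective fun k => s(p k, q k) := by
    intro k l hkl
    by_contra hne
    refine hdist k l hne ?_
    rw [hset, hset]
    rcases Sym2.eq_iff.1 hkl with ⟨h1, h2⟩ | ⟨h1, h2⟩
    · rw [h1, h2]
    · rw [h1, h2, pair_comm]
  have hother : ∀ k i, i ≠ p k → i ≠ q k → Disjoint (C k) (S i) := by
    intro k i h1 h2
    rw [disjoint_iff_inter_eq_empty, ← not_nonempty_iff_eq_empty]
    exact fun h => (honly k i h).elim h1 h2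
  rcases le_or_gt n 12 with hn | hn
  · have h1 : Fintype.card (Fin m) ≤ Fintype.card {e : Sym2 (Fin n) // ¬ e.IsDiag} :=
      Fintype.card_le_of_injective (fun k => ⟨s(p k, q k), hpq k⟩) fun k l h =>
        hinj (congrArg Subtype.val h)
    rw [Sym2.card_subtype_not_diag, Fintype.card_fin, Fintype.card_fin] at h1
    have h2 : ∀ n ≤ 12, n.choose 2 ≤ 33 * n - 25 := by decide
    exact h1.trans (h2 n hn)
  have hmono : ∀ c : Bool, Fintype.card {k // color (p k) = c ∧ color (q k) = c} ≤
      3 * Fintype.card {i // color i = c} := by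
    intro c
    refine card_le_of_drawing (fun i : {i // color i = c} => S i.1)
      (fun k : {k // color (p k) = c ∧ color (q k) = c} => C k.1)
      (fun k => ⟨p k.1, k.2.1⟩) (fun k => ⟨q k.1, k.2.2⟩)
      (fun i => (hScurve i.1).1.isPathConnected) ?_ (fun k => (hCcurve k.1).1.isPathConnected)
      ?_ (fun k => hp k.1) (fun k => hq k.1) ?_ ?_ ?_
    · exact fun i j hij => hsame i.1 j.1 (fun h => hij (Subtype.ext h)) (i.2.trans j.2.symm)
    · exact fun k l hkl => hCdisj k.1 l.1 fun h => hkl (Subtype.ext h)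
    · exact fun k h => hpq k.1 (congrArg Subtype.val h)
    · exact fun k i h1 h2 => hother k.1 i.1 (fun h => h1 (Subtype.ext h))
        fun h => h2 (Subtype.ext h)
    · intro k l hkl
      refine Subtype.ext (hinj ?_)
      exact congrArg (Sym2.map Subtype.val) hkl
  choose f hf hfC using fun k => (hCcurve k).1.exists_continuous
  obtain ⟨K, hK, hKc, hKS, hCK⟩ := hground.exists_isCompact fun i => (hScurve i).1.isClosed
  have hbi : Fintype.card {k // color (p k) ≠ color (q k)} ≤
      27 * (Fintype.card {i // color i = true} + Fintype.card {i // color i = false}) + 12 := by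
    refine card_le_of_bicolored (K := K) (fun i : {i // color i = true} => S i.1)
      (fun i : {i // color i = false} => S i.1)
      (fun k : {k // color (p k) ≠ color (q k)} => f k.1)
      (fun k => ⟨p k.1, (hcol k.1 k.2).1⟩) (fun k => ⟨q k.1, (hcol k.1 k.2).2⟩)
      (fun i => (hScurve i.1).1.isPathConnected) (fun i => (hScurve i.1).1.isClosed) ?_
      (fun i => (hScurve i.1).1.isPathConnected) (fun i => (hScurve i.1).1.isClosed) ?_
      (fun k => hf k.1) ?_ ?_ ?_ ?_ ?_ hK hKc (fun i => hKS i.1) (fun i => hKS i.1) ?_ ?_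
    · exact fun i j hij => hsame i.1 j.1 (fun h => hij (Subtype.ext h)) (i.2.trans j.2.symm)
    · exact fun i j hij => hsame i.1 j.1 (fun h => hij (Subtype.ext h)) (i.2.trans j.2.symm)
    · intro k l hkl
      rw [← hfC, ← hfC]
      exact hCdisj k.1 l.1 fun h => hkl (Subtype.ext h)
    · intro k
      rw [← hfC]
      exact hp k.1
    · intro k i hi
      rw [← hfC]
      refine hother k.1 i.1 (fun h => hi (Subtype.ext h)) fun h => ?_
      have := i.2
      rw [h, (hcol k.1 k.2).2] at this
      exact absurd this (by decide)
    · intro k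
      rw [← hfC]
      exact hq k.1
    · intro k i hi
      rw [← hfC]
      refine hother k.1 i.1 (fun h => ?_) fun h => hi (Subtype.ext h)
      have := i.2
      rw [h, (hcol k.1 k.2).1] at this
      exact absurd this (by decide)
    · intro k
      rw [← hfC]
      exact hCK k.1
    · intro k l hkl
      simp only [Prod.mk.injEq, Subtype.mk.injEq] at hkl
      refine Subtype.ext (hinj ?_)
      simp only [hkl.1, hkl.2]
  have hn2 : Fintype.card {i // color i = true} + Fintype.card {i // color i = false} = n := by
    have h := Finset.card_filter_add_card_filter_not (s := (Finset.univ : Finset (Fin n)))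
      fun i => color i = true
    simpa [Fintype.card_subtype] using h
  have hm : m ≤ Fintype.card {k // color (p k) = true ∧ color (q k) = true} +
      Fintype.card {k // color (p k) = false ∧ color (q k) = false} +
      Fintype.card {k // color (p k) ≠ color (q k)} := by
    simp only [Fintype.card_subtype]
    calc m = (Finset.univ : Finset (Fin m)).card := by simp
      _ ≤ _ := Finset.card_le_card (t := (Finset.univ.filter fun k => color (p k) = true ∧
          color (q k) = true) ∪ (Finset.univ.filter fun k => color (p k) = false ∧
          color (q k) = false) ∪ Finset.univ.filter fun k => color (p k) ≠ color (q k)) ?_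
      _ ≤ _ := (Finset.card_union_le _ _).trans (by gcongr; exact Finset.card_union_le _ _)
    intro k _
    simp only [Finset.mem_union, Finset.mem_filter, Finset.mem_univ, true_and]
    cases color (p k) <;> cases color (q k) <;> simp
  have h1 := hmono true
  have h2 := hmono false
  omega
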